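/- For the Euclidean control system with Hamiltonians H_u(q,p) = |p|²/2 + V_0(q) + Σ_{j=1}^d u_j q_j + u_{d+1} e^{−|q|²/2}, finite ensembles of points are small-time exactly controllable: for every N ∈ ℕ, every N pairwise distinct points (q^1,p^1), …, (q^N,p^N) ∈ ℝ^d × ℝ^d, every N pairwise distinct points (q̄^1,p̄^1), …, (q̄^N,p̄^N) ∈ ℝ^d × ℝ^d, and every ε > 0, there exist τ ∈ [0,ε] and a piecewise constant control u(·) on [0,τ] such that Φ^τ_{H_u}(q^i,p^i) = (q̄^i,p̄^i) for every i ∈ {1,…,N}. -/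

import Mathlib

open MeasureTheory Real

noncomputable section

/-- The phase space `T*ℝ^d = ℝ^d × ℝ^d` (positions `q` and momenta `p`),
identified with `ℝ^{2d}` with the sup norm and the Lebesgue (symplectic volume) measure. -/
abbrev Phase (d : ℕ) := (Fin d → ℝ) × (Fin d → ℝ)

/-- The Hamiltonian vector field of a function `H : Phase d → ℝ`:
`H⃗(q,p) = (∂_p H(q,p), −∂_q H(q,p))`. -/
def hamVF {d : ℕ} (H : Phase d → ℝ) (x : Phase d) : Phase d :=
  (fun i => fderiv ℝ H x (0, Pi.single i 1),
   fun i => -(fderiv ℝ H x (Pi.single i 1, 0)))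

/-- `φ` is the global flow of the (complete) vector field `X`. -/
def IsFlowOf {d : ℕ} (X : Phase d → Phase d) (φ : ℝ → Phase d → Phase d) : Prop :=
  (∀ x, φ 0 x = x) ∧ ∀ x t, HasDerivAt (fun s => φ s x) (X (φ t x)) t

/-- `Φ` is a smooth diffeomorphism of phase space. -/
def IsDiffeo {d : ℕ} (Φ : Phase d → Phase d) : Prop :=
  ContDiff ℝ (⊤ : ℕ∞) Φ ∧
    ∃ Ψ, ContDiff ℝ (⊤ : ℕ∞) Ψ ∧ Function.LeftInverse Ψ Φ ∧ Function.RightInverse Ψ Φ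

/-- `Φ` is a Hamiltonian diffeomorphism of `T*ℝ^d`: a smooth diffeomorphism which is the
time-1 flow map of a smooth time-dependent Hamiltonian whose non-autonomous Hamiltonian flow
is defined on `[0,1]` from every initial point. -/
def IsHamDiffeo {d : ℕ} (Φ : Phase d → Phase d) : Prop :=
  IsDiffeo Φ ∧
  ∃ (H : ℝ → Phase d → ℝ) (φ : ℝ → Phase d → Phase d),
    ContDiff ℝ (⊤ : ℕ∞) (fun z : ℝ × Phase d => H z.1 z.2) ∧
    (∀ x, φ 0 x = x) ∧
    (∀ x, ∀ t ∈ Set.Icc (0:ℝ) 1,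
      HasDerivWithinAt (fun s => φ s x) (hamVF (H t) (φ t x)) (Set.Icc (0:ℝ) 1) t) ∧
    Φ = φ 1

/-- `Φ` is the flow map from time `0` to time `τ` of the time-dependent Hamiltonian vector
field `H⃗_{u(t)}` for some piecewise constant control `u(·) : [0,τ] → U` (finitely many
pieces): i.e. `Φ` is a finite composition of flows of the autonomous fields `H⃗_{u_i}`
for nonnegative durations summing to `τ`. -/
def Reachable {d : ℕ} {U : Type*} (Ham : U → Phase d → ℝ) (τ : ℝ)
    (Φ : Phase d → Phase d) : Prop :=
  ∃ (n : ℕ) (dur : Fin n → ℝ) (u : Fin n → U) (φ : Fin n → ℝ → Phase d → Phase d),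
    (∀ i, 0 ≤ dur i) ∧ (∑ i, dur i) = τ ∧
    (∀ i, IsFlowOf (hamVF (Ham (u i))) (φ i)) ∧
    Φ = (List.ofFn (fun i => φ i (dur i))).foldl (fun g f => f ∘ g) id

/-- `‖Φ − Ψ‖_{C^ℓ(K)} < ε`: all iterated derivatives of the difference up to order `ℓ`
are smaller than `ε` on `K`. -/
def CloseCl {d : ℕ} (ℓ : ℕ) (K : Set (Phase d)) (ε : ℝ) (Φ Ψ : Phase d → Phase d) : Prop :=
  ∀ j ≤ ℓ, ∀ x ∈ K, ‖iteratedFDeriv ℝ j (fun y => Φ y - Ψ y) x‖ < ε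

/-- `Ψ ∈ R̄_st`: the diffeomorphism `Ψ` is small-time approximately reachable for the
control system with controlled Hamiltonians `Ham u`, `u ∈ U`. -/
def SmallTimeReachable {d : ℕ} {U : Type*} (Ham : U → Phase d → ℝ)
    (Ψ : Phase d → Phase d) : Prop :=
  ∀ ε > 0, ∀ K : Set (Phase d), IsCompact K → ∀ ℓ : ℕ,
    ∃ τ ∈ Set.Icc (0:ℝ) ε, ∃ Φ, Reachable Ham τ Φ ∧ CloseCl ℓ K ε Φ Ψ

/-- A function `f` with complete Hamiltonian vector field is STAR (small-time approximately
reachable) if its flow at every time `s ∈ ℝ` belongs to `R̄_st`. -/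
def IsSTAR {d : ℕ} {U : Type*} (Ham : U → Phase d → ℝ) (f : Phase d → ℝ) : Prop :=
  (∃ φ, IsFlowOf (hamVF f) φ) ∧
  ∀ φ, IsFlowOf (hamVF f) φ → ∀ s : ℝ, SmallTimeReachable Ham (φ s)

/-- The Poisson bracket `{f,g} = Σ_j (∂_{p_j} f ∂_{q_j} g − ∂_{q_j} f ∂_{p_j} g)`. -/
def poissonBracket {d : ℕ} (f g : Phase d → ℝ) : Phase d → ℝ :=
  fun x => ∑ j, (fderiv ℝ f x (0, Pi.single j 1) * fderiv ℝ g x (Pi.single j 1, 0)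
      - fderiv ℝ f x (Pi.single j 1, 0) * fderiv ℝ g x (0, Pi.single j 1))

/-- The mechanical Hamiltonian `H_u(q,p) = |p|²/2 + V_0(q) + Σ_j u_j V_j(q)`. -/
def mechHam {d m : ℕ} (V0 : (Fin d → ℝ) → ℝ) (V : Fin m → (Fin d → ℝ) → ℝ)
    (u : Fin m → ℝ) : Phase d → ℝ :=
  fun x => (∑ i, (x.2 i) ^ 2) / 2 + V0 x.1 + ∑ j, u j * V j x.1

/-- The Euclidean controlled Hamiltonian
`H_u(q,p) = |p|²/2 + V_0(q) + Σ_{j=1}^d u_j q_j + u_{d+1} e^{−|q|²/2}`,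
with control `u ∈ ℝ^d × ℝ ≃ ℝ^{d+1}`. -/
def eucHam {d : ℕ} (V0 : (Fin d → ℝ) → ℝ) (u : (Fin d → ℝ) × ℝ) : Phase d → ℝ :=
  fun x => (∑ i, (x.2 i) ^ 2) / 2 + V0 x.1 + (∑ j, u.1 j * x.1 j)
    + u.2 * Real.exp (-(∑ i, (x.1 i) ^ 2) / 2)

/-- The frequencies `k_1 = e_1, …, k_{d−1} = e_{d−1}, k_d = (1,…,1)`. -/
def kvec (d : ℕ) (j : Fin d) : Fin d → ℝ :=
  if (j : ℕ) < d - 1 then Pi.single j 1 else fun _ => 1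

/-- The torus controlled Hamiltonian (lifted to `ℝ^d × ℝ^d`)
`H_u(q,p) = |p|²/2 + V_0(q) + Σ_{j=1}^d (u_{2j−1} cos(k_j·q) + u_{2j} sin(k_j·q))`,
with control `u ∈ (ℝ²)^d ≃ ℝ^{2d}`. -/
def torusHam {d : ℕ} (V0 : (Fin d → ℝ) → ℝ) (u : Fin d → ℝ × ℝ) : Phase d → ℝ :=
  fun x => (∑ i, (x.2 i) ^ 2) / 2 + V0 x.1 +
    ∑ j, ((u j).1 * Real.cos (∑ i, kvec d j i * x.1 i) +
          (u j).2 * Real.sin (∑ i, kvec d j i * x.1 i))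

/-- The vertical shear `(q,p) ↦ (q, p − ∇f(q))`. -/
def vshear {d : ℕ} (f : (Fin d → ℝ) → ℝ) : Phase d → Phase d :=
  fun x => (x.1, fun i => x.2 i - fderiv ℝ f x.1 (Pi.single i 1))

/-- The horizontal shear `(q,p) ↦ (q + ∇g(p), p)`. -/
def hshear {d : ℕ} (g : (Fin d → ℝ) → ℝ) : Phase d → Phase d :=
  fun x => (fun i => x.1 i + fderiv ℝ g x.2 (Pi.single i 1), x.2)

/-- `M` is a mesh of size `h`: the closed sup-norm cubes `C̄(m_n,h)` cover `ℝ^{2d}` and the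
open cubes `C(m_n,h)` are pairwise disjoint. -/
def IsMesh {d : ℕ} (h : ℝ) (M : ℕ → Phase d) : Prop :=
  (∀ x : Phase d, ∃ n, ‖x - M n‖ ≤ h) ∧
  ∀ n ℓ : ℕ, n ≠ ℓ →
    Disjoint {x : Phase d | ‖x - M n‖ < h} {x : Phase d | ‖x - M ℓ‖ < h}

/-- `F` is a permutation of the mesh `M` of size `h`: a bijection translating every open
cube of the mesh onto another one. -/
def IsMeshPermutation {d : ℕ} (h : ℝ) (M : ℕ → Phase d) (F : Phase d → Phase d) : Prop :=
  Function.Bijective F ∧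
  ∀ n : ℕ, ∃ ℓ : ℕ, ∀ x : Phase d, ‖x - M n‖ < h → F x = x + (M ℓ - M n)

/-- The fundamental domain `Q = [0,2π)^d × ℝ^d` of `T*𝕋^d` in `ℝ^d × ℝ^d`. -/
def torusBlock (d : ℕ) : Set (Phase d) :=
  {x : Phase d | ∀ i, 0 ≤ x.1 i ∧ x.1 i < 2 * Real.pi}

/-- A torus density of class `L^r`: a measurable function on `ℝ^d × ℝ^d`, `2π`-periodic in
each position variable, with finite `L^r` norm on the fundamental domain `Q`. -/
def IsTorusDensity {d : ℕ} (p : ENNReal) (ρ : Phase d → ℝ) : Prop :=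
  Measurable ρ ∧
  (∀ (q : Fin d → ℝ) (pp : Fin d → ℝ) (k : Fin d → ℤ),
    ρ (fun i => q i + 2 * Real.pi * (k i), pp) = ρ (q, pp)) ∧
  eLpNorm ρ p (volume.restrict (torusBlock d)) < ⊤

end
section helpers
open Set Filter Topology

theorem aux_global_flow {E : Type*} [NormedAddCommGroup E] [NormedSpace ℝ E] [CompleteSpace E]
    (f : E → E) (hf : ContDiff ℝ 1 f) (K : NNReal) (hK : LipschitzWith K f) :
    ∃ φ : ℝ → E → E, (∀ x, φ 0 x = x) ∧ ∀ x t, HasDerivAt (fun s => φ s x) (f (φ t x)) t := by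
  have key : ∀ x : E, ∃ γ : ℝ → E, γ 0 = x ∧ ∀ t, HasDerivAt γ (f (γ t)) t := by
    intro x
    have hT : (0:ℝ) < 1 / (2 * (K + 1)) := by positivity
    obtain ⟨γ, h0, h1⟩ := exists_isMIntegralCurve_of_isMIntegralCurveOn (I := modelWithCornersSelf ℝ E)
      (M := E) (v := f) (contMDiff_vectorSpace_iff_contDiff.2 hf) hT (by
        intro y
        have hpl : IsPicardLindelof (fun _ => f) (tmin := -(1 / (2 * (K + 1)) : ℝ))
            (tmax := (1 / (2 * (K + 1)) : ℝ)) ⟨0, by constructor <;> linarith⟩ y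
            (‖f y‖₊ + 1) 0 (‖f y‖₊ + K * (‖f y‖₊ + 1)) K := by
          refine ⟨fun t _ => hK.lipschitzOnWith, fun _ _ => continuousOn_const, ?_, ?_⟩
          · intro t _ z hz
            have h1 := hK.dist_le_mul z y
            rw [Metric.mem_closedBall] at hz
            rw [dist_eq_norm] at h1
            have h2 : ‖f z‖ ≤ ‖f y‖ + ‖f z - f y‖ := by
              have := norm_add_le (f y) (f z - f y); simpa using this
            have h3 : (K:ℝ) * dist z y ≤ K * (‖f y‖ + 1) := by
              gcongr; simpa using hz
            push_cast
            linarith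
          · simp only [sub_zero, zero_sub, neg_neg, max_self]
            push_cast
            rw [mul_one_div, div_le_iff₀ (by positivity)]
            have := norm_nonneg (f y)
            have := K.coe_nonneg
            nlinarith [mul_nonneg (norm_nonneg (f y)) K.coe_nonneg]
        obtain ⟨α, hα0, hα⟩ := hpl.exists_eq_forall_mem_Icc_hasDerivWithinAt₀
        refine ⟨α, hα0, fun t ht => ?_⟩
        have := (hα t (Ioo_subset_Icc_self ht)).mono Ioo_subset_Icc_self
        exact (this.hasFDerivWithinAt).hasMFDerivWithinAt) x
    exact ⟨γ, h0, fun t => by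
      have := ((h1 t).hasFDerivAt)
      exact this⟩
  choose γ h0 h1 using key
  exact ⟨fun t x => γ x t, h0, fun x t => h1 x t⟩

theorem aux_flow_neg {E : Type*} [NormedAddCommGroup E] [NormedSpace ℝ E]
    (f : E → E) (K : NNReal) (hK : LipschitzWith K f) (φ : ℝ → E → E)
    (h0 : ∀ x, φ 0 x = x) (h1 : ∀ x t, HasDerivAt (fun s => φ s x) (f (φ t x)) t) (t : ℝ) (y : E) :
    φ t (φ (-t) y) = y := by
  have := ODE_solution_unique_univ (v := fun _ => f) (s := fun _ => univ) (K := K) (t₀ := 0)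
    (f := fun s => φ s (φ (-t) y)) (g := fun s => φ (s - t) y) (fun _ => hK.lipschitzOnWith)
    (fun s => ⟨h1 _ s, trivial⟩)
    (fun s => ⟨by
      simpa using (h1 y (s - t)).comp_sub_const s t, trivial⟩)
    (by simp [h0])
  have := congrFun this t
  simpa [h0] using this

/-- Grönwall on `[0,1]` -/
theorem aux_gron {E : Type*} [NormedAddCommGroup E] [NormedSpace ℝ E] (z z' : ℝ → E) (K e : ℝ)
    (hK : 0 ≤ K) (he : 0 ≤ e) (hz : ∀ s, HasDerivAt z (z' s) s)
    (hb : ∀ s, 0 ≤ s → s ≤ 1 → ‖z' s‖ ≤ K * ‖z s‖ + e) (s : ℝ) (h0 : 0 ≤ s) (h1 : s ≤ 1) :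
    ‖z s‖ ≤ Real.exp K * (‖z 0‖ + e) := by
  have h := norm_le_gronwallBound_of_norm_deriv_right_le (f := z) (f' := z') (δ := ‖z 0‖)
    (K := K) (ε := e) (a := 0) (b := 1) (fun x _ => (hz x).continuousAt.continuousWithinAt)
    (fun x _ => (hz x).hasDerivWithinAt) le_rfl (fun x hx => hb x hx.1 hx.2.le) s ⟨h0, h1⟩
  refine h.trans ?_
  rw [sub_zero]
  refine (gronwallBound_mono (norm_nonneg _) he hK h1).trans ?_
  by_cases hK0 : K = 0
  · subst hK0; simp [gronwallBound_K0]
  · rw [gronwallBound_of_K_ne_0 hK0]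
    simp only [mul_one]
    have hKp : 0 < K := lt_of_le_of_ne hK (Ne.symm hK0)
    have : e / K * (Real.exp K - 1) ≤ Real.exp K * e := by
      rw [div_mul_eq_mul_div, div_le_iff₀ hKp]
      have h2 : Real.exp K - 1 ≤ K * Real.exp K := by
        have := Real.add_one_le_exp (-K)
        have h3 : Real.exp K * Real.exp (-K) = 1 := by rw [← Real.exp_add]; simp
        nlinarith [Real.exp_pos K]
      nlinarith
    linarith

theorem aux_gron2 {E : Type*} [NormedAddCommGroup E] [NormedSpace ℝ E] (y y' : ℝ → E) (w : E)
    (κ m : ℝ)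
    (hκ : 0 ≤ κ) (hκ1 : κ ≤ 1) (hm : 0 ≤ m) (hy : ∀ s, HasDerivAt y (y' s) s)
    (hb : ∀ s, 0 ≤ s → s ≤ 1 → ‖y' s - w‖ ≤ κ * (‖y s‖ + m)) :
    ‖y 1 - y 0 - w‖ ≤ 3 * κ * (‖y 0‖ + ‖w‖ + m) := by
  have h := aux_gron (fun s => y s - y 0 - s • w) (fun s => y' s - w) κ (κ * (‖y 0‖ + ‖w‖ + m)) hκ
    (by positivity) (by
      intro s
      simpa using ((hy s).sub_const (y 0)).fun_sub ((hasDerivAt_id s).smul_const w)) (by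
      intro s h0 h1
      refine (hb s h0 h1).trans ?_
      have : ‖y s‖ ≤ ‖y s - y 0 - s • w‖ + ‖y 0‖ + ‖w‖ := by
        have e1 : y s = (y s - y 0 - s • w) + y 0 + s • w := by abel
        have e2 : ‖s • w‖ ≤ ‖w‖ := by
          rw [norm_smul, Real.norm_of_nonneg h0]
          exact mul_le_of_le_one_left (norm_nonneg _) h1
        calc ‖y s‖ = ‖(y s - y 0 - s • w) + y 0 + s • w‖ := by rw [← e1]
          _ ≤ _ := (norm_add₃_le).trans (by linarith)
      nlinarith) 1 zero_le_one le_rfl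
  simp only [one_smul, zero_smul, sub_self, norm_zero, zero_add] at h
  refine h.trans ?_
  have : Real.exp κ ≤ 3 := (Real.exp_le_exp.2 hκ1).trans (by
    have := Real.exp_one_lt_d9; linarith)
  have h2 : 0 ≤ κ * (‖y 0‖ + ‖w‖ + m) := by positivity
  nlinarith

/-- Uniform strict differentiability of the family `G η` at `e0` as `η → 0+`. -/
structure USD {E F : Type*} [NormedAddCommGroup E] [NormedSpace ℝ E]
    [NormedAddCommGroup F] [NormedSpace ℝ F]
    (G : ℝ → E → F) (L : E →L[ℝ] F) (e0 : E) (y0 : F) : Prop where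
  tends : Tendsto (fun η => G η e0) (𝓝[>] 0) (𝓝 y0)
  approx : ∀ κ > 0, ∃ r > 0, ∀ η : ℝ, 0 < η → η < r → ∀ e ∈ Metric.ball e0 r,
    ∀ e' ∈ Metric.ball e0 r, ‖G η e - G η e' - L (e - e')‖ ≤ κ * ‖e - e'‖

section usd
variable {E F H : Type*} [NormedAddCommGroup E] [NormedSpace ℝ E]
    [NormedAddCommGroup F] [NormedSpace ℝ F] [NormedAddCommGroup H] [NormedSpace ℝ H]

theorem aux_eventually {p : ℝ → Prop} (h : ∀ᶠ η in 𝓝[>] (0:ℝ), p η) :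
    ∃ r > 0, ∀ η : ℝ, 0 < η → η < r → p η := by
  rw [eventually_nhdsWithin_iff, Metric.eventually_nhds_iff] at h
  obtain ⟨r, hr, h⟩ := h
  exact ⟨r, hr, fun η h0 h1 => h (by rw [Real.dist_eq, sub_zero, abs_of_pos h0]; exact h1) h0⟩

theorem USD.lip {G : ℝ → E → F} {L : E →L[ℝ] F} {e0 : E} {y0 : F} (h : USD G L e0 y0) :
    ∃ r > 0, ∀ η : ℝ, 0 < η → η < r → ∀ e ∈ Metric.ball e0 r,
    ∀ e' ∈ Metric.ball e0 r, ‖G η e - G η e'‖ ≤ (‖L‖ + 1) * ‖e - e'‖ := by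
  obtain ⟨r, hr, h⟩ := h.approx 1 one_pos
  refine ⟨r, hr, fun η h0 h1 e he e' he' => ?_⟩
  have h2 := h η h0 h1 e he e' he'
  have h3 := L.le_opNorm (e - e')
  have h4 := norm_add_le (G η e - G η e' - L (e - e')) (L (e - e'))
  rw [sub_add_cancel] at h4
  linarith

/-- the family stays close to the limit value -/
theorem USD.near {G : ℝ → E → F} {L : E →L[ℝ] F} {e0 : E} {y0 : F} (h : USD G L e0 y0)
    {ρ : ℝ} (hρ : 0 < ρ) :
    ∃ r > 0, ∀ η : ℝ, 0 < η → η < r → ∀ e ∈ Metric.ball e0 r, G η e ∈ Metric.ball y0 ρ := by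
  obtain ⟨r, hr, h1⟩ := h.lip
  obtain ⟨r', hr', h2⟩ := aux_eventually (h.tends (Metric.ball_mem_nhds y0 (half_pos hρ)))
  have hL : 0 < ‖L‖ + 1 := by positivity
  refine ⟨min (min r r') (ρ / 2 / (‖L‖ + 1)), by positivity, fun η h0 hη e he => ?_⟩
  simp only [lt_min_iff] at hη
  rw [Metric.mem_ball, lt_min_iff, lt_min_iff] at he
  have h3 := h1 η h0 hη.1.1 e he.1.1 e0 (Metric.mem_ball_self hr)
  have h4 : dist (G η e0) y0 < ρ / 2 := h2 η h0 hη.1.2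
  have h5 : (‖L‖ + 1) * ‖e - e0‖ < ρ / 2 := by
    rw [← dist_eq_norm, mul_comm, ← lt_div_iff₀ hL]; exact he.2
  rw [Metric.mem_ball]
  have := dist_triangle (G η e) (G η e0) y0
  rw [dist_eq_norm (G η e) (G η e0)] at this
  linarith

theorem USD.comp {G : ℝ → E → F} {L : E →L[ℝ] F} {e0 : E} {y0 : F} (h : USD G L e0 y0)
    {G' : ℝ → F → H} {L' : F →L[ℝ] H} {z0 : H} (h' : USD G' L' y0 z0) :
    USD (fun η e => G' η (G η e)) (L'.comp L) e0 z0 := by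
  refine ⟨?_, ?_⟩
  · rw [Metric.tendsto_nhds]
    intro ρ hρ
    obtain ⟨r, hr, h1⟩ := h'.near hρ
    obtain ⟨r', hr', h2⟩ := h.near hr
    have : Ioo 0 (min r r') ∈ 𝓝[>] (0:ℝ) := Ioo_mem_nhdsGT (by positivity)
    filter_upwards [this] with η hη
    have h3 := hη.2
    rw [lt_min_iff] at h3
    exact h1 η hη.1 h3.1 _ (h2 η hη.1 h3.2 _ (Metric.mem_ball_self hr'))
  · intro κ hκ
    obtain ⟨r1, hr1, h1⟩ := h'.approx (κ / 2 / (‖L‖ + 1)) (by positivity)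
    obtain ⟨r2, hr2, h2⟩ := h.approx (κ / 2 / (‖L'‖ + 1)) (by positivity)
    obtain ⟨r3, hr3, h3⟩ := h.near hr1
    obtain ⟨r4, hr4, h4⟩ := h.lip
    refine ⟨min (min r1 r2) (min r3 r4), by positivity, fun η h0 hη e he e' he' => ?_⟩
    simp only [Metric.mem_ball, lt_min_iff] at hη he he'
    have a1 := h1 η h0 hη.1.1 (G η e) (h3 η h0 hη.2.1 e he.2.1) (G η e') (h3 η h0 hη.2.1 e' he'.2.1)
    have a2 := h2 η h0 hη.1.2 e he.1.2 e' he'.1.2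
    have a3 := h4 η h0 hη.2.2 e he.2.2 e' he'.2.2
    have a4 := L'.le_opNorm (G η e - G η e' - L (e - e'))
    have e1 : G' η (G η e) - G' η (G η e') - (L'.comp L) (e - e') =
      (G' η (G η e) - G' η (G η e') - L' (G η e - G η e')) + L' (G η e - G η e' - L (e - e')) := by
      simp only [ContinuousLinearMap.comp_apply, map_sub]; abel
    rw [e1]
    refine (norm_add_le _ _).trans ?_
    have b1 : κ / 2 / (‖L‖ + 1) * ‖G η e - G η e'‖ ≤ κ / 2 * ‖e - e'‖ := by
      calc _ ≤ κ / 2 / (‖L‖ + 1) * ((‖L‖ + 1) * ‖e - e'‖) := by gcongr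
        _ = _ := by field_simp
    have b2 : ‖L'‖ * ‖G η e - G η e' - L (e - e')‖ ≤ κ / 2 * ‖e - e'‖ := by
      calc _ ≤ (‖L'‖ + 1) * (κ / 2 / (‖L'‖ + 1) * ‖e - e'‖) := by
              gcongr; linarith
        _ = _ := by field_simp
    linarith

theorem USD.prodMk {G : ℝ → E → F} {L : E →L[ℝ] F} {e0 : E} {y0 : F} (h : USD G L e0 y0)
    {G' : ℝ → E → H} {L' : E →L[ℝ] H} {z0 : H} (h' : USD G' L' e0 z0) :
    USD (fun η e => (G η e, G' η e)) (L.prod L') e0 (y0, z0) := by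
  refine ⟨h.tends.prodMk_nhds h'.tends, fun κ hκ => ?_⟩
  obtain ⟨r1, hr1, h1⟩ := h.approx κ hκ
  obtain ⟨r2, hr2, h2⟩ := h'.approx κ hκ
  refine ⟨min r1 r2, by positivity, fun η h0 hη e he e' he' => ?_⟩
  simp only [Metric.mem_ball, lt_min_iff] at hη he he'
  exact max_le (h1 η h0 hη.1 e he.1 e' he'.1) (h2 η h0 hη.2 e he.2 e' he'.2)

theorem USD.clm (L : E →L[ℝ] F) (e0 : E) : USD (fun _ e => L e) L e0 (L e0) :=
  ⟨tendsto_const_nhds, fun κ hκ => ⟨1, one_pos, fun η _ _ e _ e' _ => by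
    rw [map_sub, sub_self, norm_zero]; positivity⟩⟩

theorem USD.pi {N : ℕ} {G : Fin N → ℝ → E → F} {L : Fin N → E →L[ℝ] F} {e0 : E} {y0 : Fin N → F}
    (h : ∀ i, USD (G i) (L i) e0 (y0 i)) :
    USD (fun η e i => G i η e) (ContinuousLinearMap.pi L) e0 y0 := by
  refine ⟨tendsto_pi_nhds.2 fun i => (h i).tends, fun κ hκ => ?_⟩
  choose r hr h1 using fun i => (h i).approx κ hκ
  obtain ⟨ρ, hρ, hρ'⟩ : ∃ ρ > 0, ∀ i, ρ ≤ r i := by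
    have : ∀ᶠ ρ in 𝓝[>] (0:ℝ), ∀ i, ρ ≤ r i := by
      rw [eventually_all]
      intro i
      exact (eventually_le_nhds (hr i)).filter_mono nhdsWithin_le_nhds
    obtain ⟨ρ, h1, h2⟩ := (this.and self_mem_nhdsWithin).exists
    exact ⟨ρ, h2, h1⟩
  refine ⟨ρ, hρ, fun η h0 hη e he e' he' => ?_⟩
  rw [pi_norm_le_iff_of_nonneg (by positivity)]
  intro i
  exact h1 i η h0 (hη.trans_le (hρ' i)) e (Metric.ball_subset_ball (hρ' i) he) e'
    (Metric.ball_subset_ball (hρ' i) he')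

theorem USD.surj [CompleteSpace E] [CompleteSpace F] {G : ℝ → E × H → F} {L : E × H →L[ℝ] F}
    {x0 : H} {y0 : F}
    (h : USD G L (0, x0) y0)
    (hs : (L.comp (ContinuousLinearMap.inl ℝ E H)).range = ⊤) :
    ∃ δ > 0, ∀ η : ℝ, 0 < η → η < δ → ∀ x ∈ Metric.ball x0 δ, ∀ y ∈ Metric.ball y0 δ,
      ∃ e, G η (e, x) = y := by
  set A := L.comp (ContinuousLinearMap.inl ℝ E H) with hA
  set S := A.nonlinearRightInverseOfSurjective hs
  have hS : 0 < S.nnnorm := A.nonlinearRightInverseOfSurjective_nnnorm_pos hs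
  set c : NNReal := S.nnnorm⁻¹ / 2 with hc
  have hcpos : 0 < c := by positivity
  obtain ⟨r, hr, h1⟩ := h.approx c hcpos
  set R : ℝ := c * (r / 2) with hR
  have hRpos : 0 < R := by positivity
  obtain ⟨r', hr', h2⟩ := h.near (half_pos hRpos)
  refine ⟨min (min r r') (R / 2), by positivity, fun η h0 hη x hx y hy => ?_⟩
  simp only [Metric.mem_ball, lt_min_iff] at hη hx hy
  have happ : ApproximatesLinearOn (fun e => G η (e, x)) A (Metric.ball 0 r) c := by
    intro e he e' he'
    have := h1 η h0 hη.1.1 (e, x) (by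
      simp only [Metric.mem_ball, Prod.dist_eq, max_lt_iff] at he ⊢; exact ⟨he, hx.1.1⟩) (e', x) (by
      simp only [Metric.mem_ball, Prod.dist_eq, max_lt_iff] at he' ⊢; exact ⟨he', hx.1.1⟩)
    simpa [hA, Prod.norm_def] using this
  have hsurj := happ.surjOn_closedBall_of_nonlinearRightInverse S (ε := r / 2) (b := 0) (by positivity)
    (Metric.closedBall_subset_ball (by linarith))
  have h3 : dist (G η (0, x)) y0 < R / 2 := h2 η h0 hη.1.2 (0, x) (by
      simp only [Metric.mem_ball, Prod.dist_eq, max_lt_iff, dist_self]; exact ⟨hr', hx.1.2⟩)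
  obtain ⟨e, _, he⟩ := hsurj (a := y) (by
    rw [Metric.mem_closedBall]
    have e1 : ((S.nnnorm : ℝ)⁻¹ - c) * (r / 2) = R := by
      rw [hR, hc]; push_cast; ring
    rw [e1]
    have := dist_triangle y y0 (G η (0, x))
    rw [dist_comm y0] at this
    linarith)
  exact ⟨e, he⟩
end usd

section elem
variable {Q : Type*} [NormedAddCommGroup Q] [NormedSpace ℝ Q]

/-- derivative of the ideal kick at `g = 0` -/
noncomputable def kickL (b0 : Q) : ℝ × (Q × Q) →L[ℝ] Q × Q :=
  ((ContinuousLinearMap.fst ℝ Q Q).comp (ContinuousLinearMap.snd ℝ ℝ (Q × Q))).prod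
    ((ContinuousLinearMap.snd ℝ Q Q).comp (ContinuousLinearMap.snd ℝ ℝ (Q × Q)) -
      (ContinuousLinearMap.fst ℝ ℝ (Q × Q)).smulRight b0)

theorem kickL_apply (b0 : Q) (e : ℝ × (Q × Q)) :
    kickL b0 e = (e.2.1, e.2.2 - e.1 • b0) := rfl

/-- the ideal drift -/
noncomputable def driftL : (Q × Q) →L[ℝ] Q × Q :=
  ((ContinuousLinearMap.fst ℝ Q Q) + (ContinuousLinearMap.snd ℝ Q Q)).prod
    (ContinuousLinearMap.snd ℝ Q Q)

theorem driftL_apply (e : Q × Q) : driftL e = (e.1 + e.2, e.2) := rfl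

theorem aux_le_of_le {x y : Q} {L : ℝ} {a : Q → Q} (ha : ∀ x y, ‖a x - a y‖ ≤ L * ‖x - y‖) :
    ‖a x‖ ≤ ‖a y‖ + L * ‖x - y‖ := by
  have := norm_add_le (a y) (a x - a y)
  rw [add_sub_cancel] at this
  linarith [ha x y]

theorem drift_usd (a : Q → Q) (La : ℝ) (hLa : 0 ≤ La)
    (ha : ∀ x y, ‖a x - a y‖ ≤ La * ‖x - y‖)
    (k : ℝ → (Q × Q) → Q × Q)
    (hk : ∀ η : ℝ, 0 < η → ∀ x : Q × Q, ∃ q P : ℝ → Q, q 0 = x.1 ∧ P 0 = x.2 ∧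
      k η x = (q 1, P 1) ∧ (∀ s, HasDerivAt q (P s) s) ∧
      ∀ s, HasDerivAt P (-(η ^ 2 • a (q s))) s) (x0 : Q × Q) :
    USD k driftL x0 (driftL x0) := by
  refine ⟨?_, fun κ hκ => ?_⟩
  · -- limit value
    set C : ℝ := ‖a x0.1‖ + La * ‖x0.2‖ with hC
    have hC0 : 0 ≤ C := by positivity
    have key : ∀ η : ℝ, 0 < η → η < 1 → ‖k η x0 - driftL x0‖ ≤ 2 * (Real.exp (2 * La) * (η * C)) := by
      intro η h0 h1
      obtain ⟨q, P, hq0, hP0, hk1, hq, hP⟩ := hk η h0 x0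
      have h2 : η ^ 2 ≤ η := by nlinarith
      have hg := aux_gron (fun s => (q s - x0.1 - s • P s, P s - x0.2))
        (fun s => (s • η ^ 2 • a (q s), -(η ^ 2 • a (q s)))) (2 * La) (η * C)
        (by positivity) (by positivity) (by
          intro s
          have e1 := ((hq s).sub_const x0.1).fun_sub ((hasDerivAt_id s).fun_smul (hP s))
          have e2 := (hP s).sub_const x0.2
          refine HasDerivAt.prodMk ?_ e2
          convert! e1 using 1
          simp) (by
          intro s hs0 hs1
          set z : Q × Q := (q s - x0.1 - s • P s, P s - x0.2) with hz
          have n1 : ‖q s - x0.1 - s • P s‖ ≤ ‖z‖ := norm_fst_le z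
          have n2 : ‖P s - x0.2‖ ≤ ‖z‖ := norm_snd_le z
          have n3 : ‖P s‖ ≤ ‖z‖ + ‖x0.2‖ := by
            have := norm_add_le (P s - x0.2) x0.2
            rw [sub_add_cancel] at this; linarith
          have n4 : ‖s • P s‖ ≤ ‖P s‖ := by
            rw [norm_smul, Real.norm_of_nonneg hs0]
            exact mul_le_of_le_one_left (norm_nonneg _) hs1
          have n5 : ‖q s - x0.1‖ ≤ 2 * ‖z‖ + ‖x0.2‖ := by
            have := norm_add_le (q s - x0.1 - s • P s) (s • P s)
            rw [sub_add_cancel] at this; linarith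
          have n6 : ‖a (q s)‖ ≤ C + 2 * La * ‖z‖ := by
            have := aux_le_of_le (x := q s) (y := x0.1) ha
            nlinarith
          have n7 : ‖η ^ 2 • a (q s)‖ ≤ η * (C + 2 * La * ‖z‖) := by
            rw [norm_smul, Real.norm_of_nonneg (by positivity)]
            gcongr
          have n8 : η * (C + 2 * La * ‖z‖) ≤ 2 * La * ‖z‖ + η * C := by
            have : 0 ≤ 2 * La * ‖z‖ := by positivity
            nlinarith
          refine max_le ?_ ?_
          · change ‖s • η ^ 2 • a (q s)‖ ≤ _
            rw [norm_smul, Real.norm_of_nonneg hs0]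
            have := mul_le_of_le_one_left (norm_nonneg (η ^ 2 • a (q s))) hs1
            linarith
          · change ‖-(η ^ 2 • a (q s))‖ ≤ _
            rw [norm_neg]; linarith) 1 zero_le_one le_rfl
      simp only [hq0, hP0, sub_self, zero_smul, one_smul] at hg
      rw [show ((0:Q), (0:Q)) = 0 from rfl, norm_zero, zero_add] at hg
      have m1 := (norm_fst_le (q 1 - x0.1 - P 1, P 1 - x0.2)).trans hg
      have m2 := (norm_snd_le (q 1 - x0.1 - P 1, P 1 - x0.2)).trans hg
      simp only at m1 m2
      rw [hk1, driftL_apply]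
      refine max_le ?_ ?_
      · change ‖q 1 - (x0.1 + x0.2)‖ ≤ _
        have : q 1 - (x0.1 + x0.2) = (q 1 - x0.1 - P 1) + (P 1 - x0.2) := by abel
        rw [this]
        exact (norm_add_le _ _).trans (by linarith)
      · change ‖P 1 - x0.2‖ ≤ _
        linarith [norm_nonneg (P 1 - x0.2)]
    rw [tendsto_iff_norm_sub_tendsto_zero]
    have hlim : Tendsto (fun η : ℝ => 2 * (Real.exp (2 * La) * (η * C))) (𝓝[>] 0) (𝓝 0) := by
      have : Continuous (fun η : ℝ => 2 * (Real.exp (2 * La) * (η * C))) := by fun_prop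
      have := this.tendsto 0
      simp only [zero_mul, mul_zero] at this
      exact this.mono_left nhdsWithin_le_nhds
    refine squeeze_zero' (Eventually.of_forall fun _ => norm_nonneg _) ?_ hlim
    filter_upwards [Ioo_mem_nhdsGT (zero_lt_one (α := ℝ))] with η hη
    exact key η hη.1 hη.2
  · -- differences
    set M : ℝ := 2 * La + 1 with hM
    have hMpos : 0 < M := by positivity
    refine ⟨min (1 / M) (κ / (12 * M)), by positivity, fun η h0 hη e _ e' _ => ?_⟩
    rw [lt_min_iff] at hη
    have hM1 : 1 ≤ M := by linarith
    have hηM : M * η ≤ 1 := by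
      have := (lt_div_iff₀ hMpos).1 hη.1; linarith
    have hη1 : η ≤ 1 := by nlinarith
    have hηκ : 12 * (M * η) ≤ κ := by
      have := (lt_div_iff₀ (by positivity)).1 hη.2; linarith
    have h2 : η ^ 2 ≤ η := by nlinarith
    obtain ⟨q, P, hq0, hP0, hk1, hq, hP⟩ := hk η h0 e
    obtain ⟨q', P', hq0', hP0', hk1', hq', hP'⟩ := hk η h0 e'
    have hg := aux_gron2 (fun s => (q s - q' s - s • (P s - P' s), P s - P' s))
        (fun s => (s • η ^ 2 • (a (q s) - a (q' s)), -(η ^ 2 • (a (q s) - a (q' s))))) 0 (M * η) 0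
        (by positivity) hηM le_rfl (by
          intro s
          have e1 := ((hq s).fun_sub (hq' s)).fun_sub
            ((hasDerivAt_id s).fun_smul ((hP s).fun_sub (hP' s)))
          have e2 := (hP s).fun_sub (hP' s)
          refine HasDerivAt.prodMk ?_ ?_
          · convert! e1 using 1
            simp only [id, one_smul, smul_sub, smul_neg]
            abel
          · convert! e2 using 1
            rw [smul_sub]; abel) (by
          intro s hs0 hs1
          set z : Q × Q := (q s - q' s - s • (P s - P' s), P s - P' s) with hz
          have n1 : ‖q s - q' s - s • (P s - P' s)‖ ≤ ‖z‖ := norm_fst_le z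
          have n2 : ‖P s - P' s‖ ≤ ‖z‖ := norm_snd_le z
          have n4 : ‖s • (P s - P' s)‖ ≤ ‖P s - P' s‖ := by
            rw [norm_smul, Real.norm_of_nonneg hs0]
            exact mul_le_of_le_one_left (norm_nonneg _) hs1
          have n5 : ‖q s - q' s‖ ≤ 2 * ‖z‖ := by
            have := norm_add_le (q s - q' s - s • (P s - P' s)) (s • (P s - P' s))
            rw [sub_add_cancel] at this; linarith
          have n6 : ‖a (q s) - a (q' s)‖ ≤ M * ‖z‖ := by
            have := ha (q s) (q' s)
            nlinarith [norm_nonneg z]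
          have n7 : ‖η ^ 2 • (a (q s) - a (q' s))‖ ≤ η * (M * ‖z‖) := by
            rw [norm_smul, Real.norm_of_nonneg (by positivity)]
            gcongr
          rw [sub_zero]
          refine max_le ?_ ?_
          · change ‖s • η ^ 2 • (a (q s) - a (q' s))‖ ≤ _
            rw [norm_smul, Real.norm_of_nonneg hs0]
            have := mul_le_of_le_one_left (norm_nonneg (η ^ 2 • (a (q s) - a (q' s)))) hs1
            linarith
          · change ‖-(η ^ 2 • (a (q s) - a (q' s)))‖ ≤ _
            rw [norm_neg]; linarith)
    simp only [hq0, hP0, hq0', hP0', zero_smul, one_smul, sub_zero, norm_zero, add_zero] at hg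
    rw [show ((e.1 - e'.1, e.2 - e'.2) : Q × Q) = e - e' from rfl] at hg
    have m1 := (norm_fst_le _).trans hg
    have m2 := (norm_snd_le _).trans hg
    simp only [Prod.fst_sub, Prod.snd_sub] at m1 m2
    have hfin : 3 * (M * η) * ‖e - e'‖ ≤ κ / 2 * ‖e - e'‖ := by
      gcongr; linarith
    rw [hk1, hk1', driftL_apply]
    refine max_le ?_ ?_
    · change ‖q 1 - q' 1 - ((e.1 - e'.1) + (e.2 - e'.2))‖ ≤ _
      have : q 1 - q' 1 - ((e.1 - e'.1) + (e.2 - e'.2)) =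
        (q 1 - q' 1 - (P 1 - P' 1) - (e.1 - e'.1)) + (P 1 - P' 1 - (e.2 - e'.2)) := by abel
      rw [this]
      exact (norm_add_le _ _).trans (by linarith)
    · change ‖P 1 - P' 1 - (e.2 - e'.2)‖ ≤ _
      have : 0 ≤ κ / 2 * ‖e - e'‖ := by positivity
      linarith

end elem

section elem2
variable {Q : Type*} [NormedAddCommGroup Q] [NormedSpace ℝ Q]

theorem kick_apriori (a b : Q → Q) (La Bd : ℝ) (hLa : 0 ≤ La) (hBd : 0 ≤ Bd)
    (ha : ∀ x y, ‖a x - a y‖ ≤ La * ‖x - y‖) (hb : ∀ x, ‖b x‖ ≤ Bd) (u : Q)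
    (η : ℝ) (h0 : 0 < η) (h1 : η < 1) (g : ℝ) (q P : ℝ → Q)
    (hq : ∀ s, HasDerivAt q (η • P s) s)
    (hP : ∀ s, HasDerivAt P (-(η ^ 3 • a (q s)) - u - g • b (q s)) s)
    (x0 : Q × Q) (s : ℝ) (hs0 : 0 ≤ s) (hs1 : s ≤ 1) :
    ‖((q s - x0.1, P s - x0.2 + s • u) : Q × Q)‖ ≤ Real.exp (1 + La) *
      (‖((q 0, P 0) : Q × Q) - x0‖ + (η * (‖x0.2‖ + ‖u‖ + ‖a x0.1‖) + |g| * Bd)) := by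
  have hg := aux_gron (fun s => ((q s - x0.1, P s - x0.2 + s • u) : Q × Q))
    (fun s => (η • P s, -(η ^ 3 • a (q s)) - g • b (q s))) (1 + La)
    (η * (‖x0.2‖ + ‖u‖ + ‖a x0.1‖) + |g| * Bd) (by positivity) (by positivity) (by
      intro s
      have e2 := ((hP s).sub_const x0.2).fun_add ((hasDerivAt_id s).smul_const u)
      refine HasDerivAt.prodMk ((hq s).sub_const _) ?_
      convert! e2 using 1
      simp only [one_smul]
      abel) (by
      intro s hs0 hs1
      set z : Q × Q := (q s - x0.1, P s - x0.2 + s • u) with hz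
      have n1 : ‖q s - x0.1‖ ≤ ‖z‖ := norm_fst_le z
      have n2 : ‖P s - x0.2 + s • u‖ ≤ ‖z‖ := norm_snd_le z
      have n4 : ‖s • u‖ ≤ ‖u‖ := by
        rw [norm_smul, Real.norm_of_nonneg hs0]
        exact mul_le_of_le_one_left (norm_nonneg _) hs1
      have n3 : ‖P s‖ ≤ ‖z‖ + ‖x0.2‖ + ‖u‖ := by
        have e : P s = (P s - x0.2 + s • u) + x0.2 - s • u := by abel
        have m1 := norm_sub_le ((P s - x0.2 + s • u) + x0.2) (s • u)
        have m2 := norm_add_le (P s - x0.2 + s • u) x0.2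
        rw [← e] at m1; linarith
      have n6 : ‖a (q s)‖ ≤ ‖a x0.1‖ + La * ‖z‖ := by
        have := aux_le_of_le (x := q s) (y := x0.1) ha
        nlinarith
      have h3 : η ^ 3 ≤ η := by
        calc η ^ 3 = η * (η * η) := by ring
          _ ≤ η * 1 := by gcongr; nlinarith
          _ = η := by ring
      have n7 : ‖η ^ 3 • a (q s)‖ ≤ η * (‖a x0.1‖ + La * ‖z‖) := by
        rw [norm_smul, Real.norm_of_nonneg (by positivity)]
        gcongr
      have n8 : ‖g • b (q s)‖ ≤ |g| * Bd := by
        rw [norm_smul, Real.norm_eq_abs]; gcongr; exact hb _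
      have p1 : 0 ≤ |g| * Bd := by positivity
      have p2 : η * ‖z‖ ≤ ‖z‖ := mul_le_of_le_one_left (norm_nonneg _) h1.le
      have p3 : η * (La * ‖z‖) ≤ La * ‖z‖ := mul_le_of_le_one_left (by positivity) h1.le
      have p4 : 0 ≤ La * ‖z‖ := by positivity
      have p5 : 0 ≤ η * ‖a x0.1‖ := by positivity
      have p6 : 0 ≤ η * ‖x0.2‖ := by positivity
      have p7 : 0 ≤ η * ‖u‖ := by positivity
      refine max_le ?_ ?_
      · change ‖η • P s‖ ≤ _
        rw [norm_smul, Real.norm_of_nonneg h0.le]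
        have : η * ‖P s‖ ≤ η * (‖z‖ + ‖x0.2‖ + ‖u‖) := by gcongr
        linarith
      · change ‖-(η ^ 3 • a (q s)) - g • b (q s)‖ ≤ _
        have := norm_sub_le (-(η ^ 3 • a (q s))) (g • b (q s))
        rw [norm_neg] at this
        have := norm_nonneg z
        linarith) s hs0 hs1
  simp only [zero_smul, add_zero] at hg
  exact hg

set_option maxHeartbeats 4000000 in
theorem kick_usd (a b : Q → Q) (La Lb Bd : ℝ) (hLa : 0 ≤ La) (hLb : 0 ≤ Lb) (hBd : 0 ≤ Bd)
    (ha : ∀ x y, ‖a x - a y‖ ≤ La * ‖x - y‖) (hb : ∀ x, ‖b x‖ ≤ Bd)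
    (hb' : ∀ x y, ‖b x - b y‖ ≤ Lb * ‖x - y‖) (u : Q)
    (k : ℝ → ℝ × (Q × Q) → Q × Q)
    (hk : ∀ η : ℝ, 0 < η → ∀ e : ℝ × (Q × Q), ∃ q P : ℝ → Q, q 0 = e.2.1 ∧ P 0 = e.2.2 ∧
      k η e = (q 1, P 1) ∧ (∀ s, HasDerivAt q (η • P s) s) ∧
      ∀ s, HasDerivAt P (-(η ^ 3 • a (q s)) - u - e.1 • b (q s)) s) (x0 : Q × Q) :
    USD k (kickL (b x0.1)) (0, x0) (x0.1, x0.2 - u) := by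
  set C : ℝ := ‖x0.2‖ + ‖u‖ + ‖a x0.1‖ with hC
  have hC0 : 0 ≤ C := by positivity
  refine ⟨?_, fun κ hκ => ?_⟩
  · have key : ∀ η : ℝ, 0 < η → η < 1 → ‖k η (0, x0) - (x0.1, x0.2 - u)‖ ≤
        Real.exp (1 + La) * (η * C) := by
      intro η h0 h1
      obtain ⟨q, P, hq0, hP0, hk1, hq, hP⟩ := hk η h0 (0, x0)
      have hg := kick_apriori a b La Bd hLa hBd ha hb u η h0 h1 0 q P hq hP x0 1 zero_le_one le_rfl
      simp only [hq0, hP0, one_smul, abs_zero, zero_mul, add_zero, ← hC, Prod.mk.eta, sub_self,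
        norm_zero, zero_add] at hg
      rw [hk1]
      convert! hg using 2
      ext1
      · simp
      · simp; abel
    rw [tendsto_iff_norm_sub_tendsto_zero]
    have hlim : Tendsto (fun η : ℝ => Real.exp (1 + La) * (η * C)) (𝓝[>] 0) (𝓝 0) := by
      have : Continuous (fun η : ℝ => Real.exp (1 + La) * (η * C)) := by fun_prop
      have := this.tendsto 0
      simp only [zero_mul, mul_zero] at this
      exact this.mono_left nhdsWithin_le_nhds
    refine squeeze_zero' (Eventually.of_forall fun _ => norm_nonneg _) ?_ hlim
    filter_upwards [Ioo_mem_nhdsGT (zero_lt_one (α := ℝ))] with η hη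
    exact key η hη.1 hη.2
  · set D : ℝ := Real.exp (1 + La) * (1 + C + Bd) with hD
    have hDpos : 0 < D := by positivity
    set M : ℝ := 1 + La + Lb * D + Lb with hM
    have hMpos : 0 < M := by positivity
    have hM1 : 1 ≤ M := by
      have : 0 ≤ Lb * D := by positivity
      linarith
    set W : ℝ := 3 * M * (Bd + 2) with hW
    have hWpos : 0 < W := by positivity
    refine ⟨min (1 / M) (κ / W), by positivity, ?_⟩
    set r := min (1 / M) (κ / W) with hr
    have hrpos : 0 < r := by positivity
    have hMr : M * r ≤ 1 := by
      have := (le_div_iff₀ hMpos).1 (min_le_left (1 / M) (κ / W)); linarith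
    have hWr : W * r ≤ κ := by
      have := (le_div_iff₀ hWpos).1 (min_le_right (1 / M) (κ / W)); linarith
    have hr1 : r ≤ 1 := by nlinarith
    intro η h0 hη e he e' he'
    have hη1 : η < 1 := hη.trans_le hr1
    simp only [Metric.mem_ball, Prod.dist_eq, max_lt_iff, dist_zero_right, Real.norm_eq_abs] at he he'
    obtain ⟨q, P, hq0, hP0, hk1, hq, hP⟩ := hk η h0 e
    obtain ⟨q', P', hq0', hP0', hk1', hq', hP'⟩ := hk η h0 e'
    have hclose : ∀ s, 0 ≤ s → s ≤ 1 → ‖q s - x0.1‖ ≤ D * r := by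
      intro s hs0 hs1
      have hg := kick_apriori a b La Bd hLa hBd ha hb u η h0 hη1 e.1 q P hq hP x0 s hs0 hs1
      refine (norm_fst_le _).trans (hg.trans ?_)
      rw [hq0, hP0, hD, mul_assoc]
      have m1 : ‖e.2 - x0‖ ≤ r := by
        rw [← dist_eq_norm, Prod.dist_eq]; exact max_le he.2.1.le he.2.2.le
      have m2 : η * C ≤ r * C := by gcongr
      have m3 : |e.1| * Bd ≤ r * Bd := by gcongr; exact he.1.le
      gcongr
      change ‖e.2 - x0‖ + _ ≤ _
      linarith
    have hg := aux_gron2 (fun s => ((q s - q' s, P s - P' s) : Q × Q))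
      (fun s => (η • (P s - P' s), -(η ^ 3 • (a (q s) - a (q' s))) - (e.1 - e'.1) • b (q s) -
        e'.1 • (b (q s) - b (q' s)))) (0, -((e.1 - e'.1) • b x0.1)) (M * r) |e.1 - e'.1|
        (by positivity) hMr (abs_nonneg _) (by
          intro s
          have e2 := (hP s).fun_sub (hP' s)
          refine HasDerivAt.prodMk ?_ ?_
          · rw [smul_sub]; exact (hq s).fun_sub (hq' s)
          · convert! e2 using 1
            simp only [smul_sub, sub_smul]
            abel) (by
          intro s hs0 hs1
          set z : Q × Q := (q s - q' s, P s - P' s) with hz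
          have n1 : ‖q s - q' s‖ ≤ ‖z‖ := norm_fst_le z
          have n2 : ‖P s - P' s‖ ≤ ‖z‖ := norm_snd_le z
          have hz0 : 0 ≤ ‖z‖ := norm_nonneg z
          have n6 : ‖a (q s) - a (q' s)‖ ≤ La * ‖z‖ := (ha _ _).trans (by gcongr)
          have n9 : ‖b (q s) - b (q' s)‖ ≤ Lb * ‖z‖ := (hb' _ _).trans (by gcongr)
          have n10 : ‖b (q s) - b x0.1‖ ≤ Lb * (D * r) :=
            (hb' _ _).trans (by gcongr; exact hclose s hs0 hs1)
          have h3 : η ^ 3 ≤ r := by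
            have : η ^ 3 ≤ η := by
              calc η ^ 3 = η * (η * η) := by ring
                _ ≤ η * 1 := by gcongr; nlinarith
                _ = η := by ring
            linarith
          have n7 : ‖η ^ 3 • (a (q s) - a (q' s))‖ ≤ r * (La * ‖z‖) := by
            rw [norm_smul, Real.norm_of_nonneg (by positivity)]
            gcongr
          have n8 : ‖(e.1 - e'.1) • (b (q s) - b x0.1)‖ ≤ |e.1 - e'.1| * (Lb * (D * r)) := by
            rw [norm_smul, Real.norm_eq_abs]; gcongr
          have n11 : ‖e'.1 • (b (q s) - b (q' s))‖ ≤ r * (Lb * ‖z‖) := by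
            rw [norm_smul, Real.norm_eq_abs]; gcongr; exact he'.1.le
          have n12 : ‖η • (P s - P' s)‖ ≤ r * ‖z‖ := by
            rw [norm_smul, Real.norm_of_nonneg h0.le]; gcongr
          have hab : 0 ≤ |e.1 - e'.1| := abs_nonneg _
          have hmain : r * (La * ‖z‖) + |e.1 - e'.1| * (Lb * (D * r)) + r * (Lb * ‖z‖) + r * ‖z‖ ≤
              M * r * (‖z‖ + |e.1 - e'.1|) := by
            rw [hM]
            have t1 : 0 ≤ r * |e.1 - e'.1| := by positivity
            have t2 : 0 ≤ La * (r * |e.1 - e'.1|) := by positivity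
            have t3 : 0 ≤ Lb * (r * |e.1 - e'.1|) := by positivity
            have t4 : 0 ≤ Lb * D * (r * ‖z‖) := by positivity
            linarith
          have q1 : 0 ≤ r * (La * ‖z‖) := by positivity
          have q2 : 0 ≤ |e.1 - e'.1| * (Lb * (D * r)) := by positivity
          have q3 : 0 ≤ r * (Lb * ‖z‖) := by positivity
          have q4 : 0 ≤ r * ‖z‖ := by positivity
          refine max_le ?_ ?_
          · change ‖η • (P s - P' s) - 0‖ ≤ _
            rw [sub_zero]; linarith
          · change ‖-(η ^ 3 • (a (q s) - a (q' s))) - (e.1 - e'.1) • b (q s) -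
              e'.1 • (b (q s) - b (q' s)) - -((e.1 - e'.1) • b x0.1)‖ ≤ _
            have eq1 : -(η ^ 3 • (a (q s) - a (q' s))) - (e.1 - e'.1) • b (q s) -
              e'.1 • (b (q s) - b (q' s)) - -((e.1 - e'.1) • b x0.1) =
              -(η ^ 3 • (a (q s) - a (q' s)) + (e.1 - e'.1) • (b (q s) - b x0.1) +
              e'.1 • (b (q s) - b (q' s))) := by
              rw [smul_sub (e.1 - e'.1)]; abel
            rw [eq1, norm_neg]
            refine (norm_add₃_le).trans ?_
            linarith)
    simp only [hq0, hP0, hq0', hP0'] at hg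
    have w1 : ‖((0, -((e.1 - e'.1) • b x0.1)) : Q × Q)‖ ≤ |e.1 - e'.1| * Bd := by
      rw [Prod.norm_def]
      refine max_le ?_ ?_
      · simp only [norm_zero]; positivity
      · simp only [norm_neg, norm_smul, Real.norm_eq_abs]; gcongr; exact hb _
    have w2 : |e.1 - e'.1| ≤ ‖e - e'‖ := norm_fst_le (e - e')
    have w3 : ‖((e.2.1 - e'.2.1, e.2.2 - e'.2.2) : Q × Q)‖ ≤ ‖e - e'‖ := norm_snd_le (e - e')
    rw [hk1, hk1', kickL_apply]
    have eqf : ((q 1, P 1) : Q × Q) - (q' 1, P' 1) - ((e - e').2.1, (e - e').2.2 - (e - e').1 • b x0.1)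
      = (q 1 - q' 1, P 1 - P' 1) - (e.2.1 - e'.2.1, e.2.2 - e'.2.2) -
        (0, -((e.1 - e'.1) • b x0.1)) := by
      ext1
      · simp
      · simp; abel
    rw [eqf]
    refine hg.trans ?_
    have hE : 0 ≤ ‖e - e'‖ := norm_nonneg _
    have w4 : |e.1 - e'.1| * Bd ≤ ‖e - e'‖ * Bd := by gcongr
    calc 3 * (M * r) * (‖((e.2.1 - e'.2.1, e.2.2 - e'.2.2) : Q × Q)‖ +
          ‖((0, -((e.1 - e'.1) • b x0.1)) : Q × Q)‖ + |e.1 - e'.1|)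
        ≤ 3 * (M * r) * (‖e - e'‖ * (Bd + 2)) := by
          gcongr; linarith
      _ = W * r * ‖e - e'‖ := by rw [hW]; ring
      _ ≤ κ * ‖e - e'‖ := by gcongr

end elem2

section grads
variable {d : ℕ}

/-- gradient of the potential -/
noncomputable def potA (V0 : (Fin d → ℝ) → ℝ) (q : Fin d → ℝ) : Fin d → ℝ :=
  fun i => fderiv ℝ V0 q (Pi.single i 1)

/-- gradient of the Gaussian -/
noncomputable def potB (q : Fin d → ℝ) : Fin d → ℝ :=
  fun i => -(q i * Real.exp (-(∑ i, (q i) ^ 2) / 2))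

theorem potA_lip (V0 : (Fin d → ℝ) → ℝ) (L : NNReal) (hL : LipschitzWith L (fderiv ℝ V0))
    (x y : Fin d → ℝ) : ‖potA V0 x - potA V0 y‖ ≤ L * ‖x - y‖ := by
  rw [pi_norm_le_iff_of_nonneg (by positivity)]
  intro i
  have h1 := (fderiv ℝ V0 x - fderiv ℝ V0 y).le_opNorm (Pi.single i 1)
  have h2 := hL.dist_le_mul x y
  rw [dist_eq_norm, dist_eq_norm] at h2
  have h3 : ‖(Pi.single i 1 : Fin d → ℝ)‖ = 1 := by rw [Pi.norm_single, norm_one]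
  rw [h3, mul_one] at h1
  exact h1.trans h2

theorem aux_exp_bd (S : ℝ) : S * Real.exp (-S / 2) ≤ 2 := by
  have h := Real.add_one_le_exp (S / 2)
  have h2 : Real.exp (S / 2) * Real.exp (-S / 2) = 1 := by
    rw [← Real.exp_add]; ring_nf; exact Real.exp_zero
  have h3 := Real.exp_pos (-S / 2)
  nlinarith

theorem potB_bd (x : Fin d → ℝ) : ‖potB x‖ ≤ 3 := by
  rw [pi_norm_le_iff_of_nonneg (by positivity)]
  intro i
  set S := ∑ i, (x i) ^ 2 with hS
  have h1 : (x i) ^ 2 ≤ S := Finset.single_le_sum (f := fun i => (x i) ^ 2)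
    (fun j _ => sq_nonneg _) (Finset.mem_univ i)
  have h2 := aux_exp_bd S
  have hS0 : 0 ≤ S := (sq_nonneg _).trans h1
  have h4 : Real.exp (-S / 2) ≤ 1 := Real.exp_le_one_iff.2 (by linarith)
  have h5 := Real.exp_pos (-S / 2)
  have h3 : |x i| ≤ 1 + S := by
    rw [abs_le]; constructor <;> nlinarith
  simp only [potB, ← hS, norm_neg, norm_mul, Real.norm_eq_abs, Real.abs_exp]
  calc |x i| * Real.exp (-S / 2) ≤ (1 + S) * Real.exp (-S / 2) := by gcongr
    _ ≤ 3 := by linarith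

theorem hasFDerivAt_sumsq (x : Fin d → ℝ) :
    HasFDerivAt (fun x : Fin d → ℝ => ∑ i, (x i) ^ 2)
      (∑ i, (2 * x i) • (ContinuousLinearMap.proj i : (Fin d → ℝ) →L[ℝ] ℝ)) x := by
  refine HasFDerivAt.fun_sum fun i _ => ?_
  have := ((ContinuousLinearMap.proj (R := ℝ) (φ := fun _ : Fin d => ℝ) i).hasFDerivAt (x := x)).pow 2
  convert! this using 1
  ext v
  simp

theorem hasFDerivAt_gauss (x : Fin d → ℝ) :
    HasFDerivAt (fun x : Fin d → ℝ => Real.exp (-(∑ i, (x i) ^ 2) / 2))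
      (Real.exp (-(∑ i, (x i) ^ 2) / 2) • ((-(1/2) : ℝ) •
      ∑ i, (2 * x i) • (ContinuousLinearMap.proj i : (Fin d → ℝ) →L[ℝ] ℝ))) x := by
  have h := ((hasFDerivAt_sumsq x).const_mul (-(1/2) : ℝ)).exp
  convert! h using 1
  · ext y; congr 1; ring
  · congr 2; ring

theorem potB_comp_lip (i : Fin d) (x y : Fin d → ℝ) :
    ‖potB x i - potB y i‖ ≤ (1 + 2 * d) * ‖x - y‖ := by
  have hd : ∀ q : Fin d → ℝ, HasFDerivAt (fun q : Fin d → ℝ => potB q i)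
      (-(q i • (Real.exp (-(∑ i, (q i) ^ 2) / 2) • ((-(1/2) : ℝ) •
      ∑ i, (2 * q i) • (ContinuousLinearMap.proj i : (Fin d → ℝ) →L[ℝ] ℝ))) +
      Real.exp (-(∑ i, (q i) ^ 2) / 2) • (ContinuousLinearMap.proj i : (Fin d → ℝ) →L[ℝ] ℝ))) q := by
    intro q
    exact (((ContinuousLinearMap.proj (R := ℝ) (φ := fun _ : Fin d => ℝ) i).hasFDerivAt (x := q)).mul
      (hasFDerivAt_gauss q)).neg
  refine Convex.norm_image_sub_le_of_norm_hasFDerivWithin_le (s := univ)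
    (fun q _ => (hd q).hasFDerivWithinAt) ?_ convex_univ (mem_univ _) (mem_univ _)
  intro q _
  refine ContinuousLinearMap.opNorm_le_bound _ (by positivity) fun v => ?_
  set S := ∑ i, (q i) ^ 2 with hS
  set e := Real.exp (-S / 2) with he
  have he0 : 0 < e := Real.exp_pos _
  have hsq : ∀ j, (q j) ^ 2 ≤ S := fun j => Finset.single_le_sum (f := fun i => (q i) ^ 2)
    (fun j _ => sq_nonneg _) (Finset.mem_univ j)
  have hS0 : 0 ≤ S := Finset.sum_nonneg fun j _ => sq_nonneg _
  have he1 : e ≤ 1 := Real.exp_le_one_iff.2 (by linarith)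
  have h2 : S * e ≤ 2 := aux_exp_bd S
  simp only [neg_apply, add_apply, smul_apply, smul_eq_mul, sum_apply,
    ContinuousLinearMap.proj_apply, norm_neg]
  have e1 : q i * (e * (-(1 / 2) * ∑ x, 2 * q x * v x)) + e * v i =
      ∑ j, (-(q i * q j * e) * v j) + e * v i := by
    rw [Finset.mul_sum, Finset.mul_sum, Finset.mul_sum]
    congr 1
    exact Finset.sum_congr rfl fun j _ => by ring
  rw [e1]
  have h3 : ‖∑ j, (-(q i * q j * e) * v j)‖ ≤ ∑ j : Fin d, 2 * ‖v‖ := by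
    refine norm_sum_le_of_le _ fun j _ => ?_
    rw [norm_mul]
    refine mul_le_mul ?_ (norm_le_pi_norm v j) (norm_nonneg _) zero_le_two
    rw [norm_neg, Real.norm_eq_abs, abs_mul, abs_of_pos he0]
    have : |q i * q j| ≤ S := by
      have h4 := hsq i
      have h5 := hsq j
      rw [abs_le]; constructor <;> nlinarith [sq_nonneg (q i - q j), sq_nonneg (q i + q j)]
    nlinarith
  have h4 : ‖e * v i‖ ≤ ‖v‖ := by
    rw [norm_mul, Real.norm_of_nonneg he0.le]
    have := norm_le_pi_norm v i
    have := norm_nonneg (v i)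
    nlinarith
  have h5 := norm_add_le (∑ j, (-(q i * q j * e) * v j)) (e * v i)
  simp only [Finset.sum_const, Finset.card_univ, Fintype.card_fin, nsmul_eq_mul] at h3
  linarith

theorem potB_lip (x y : Fin d → ℝ) : ‖potB x - potB y‖ ≤ (1 + 2 * d) * ‖x - y‖ := by
  rw [pi_norm_le_iff_of_nonneg (by positivity)]
  intro i
  exact potB_comp_lip i x y

/-- explicit form of the Hamiltonian vector field -/
noncomputable def eucVF (V0 : (Fin d → ℝ) → ℝ) (u : (Fin d → ℝ) × ℝ) (x : Phase d) : Phase d :=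
  (x.2, -(potA V0 x.1) - u.1 - u.2 • potB x.1)

theorem hamVF_eucHam (V0 : (Fin d → ℝ) → ℝ) (hV0 : ContDiff ℝ (⊤ : ℕ∞) V0)
    (u : (Fin d → ℝ) × ℝ) : hamVF (eucHam V0 u) = eucVF V0 u := by
  funext x
  have hdV : HasFDerivAt V0 (fderiv ℝ V0 x.1) x.1 :=
    (hV0.differentiable (by simp)).differentiableAt.hasFDerivAt
  have f1 := (hasFDerivAt_sumsq x.2).comp x (hasFDerivAt_snd (𝕜 := ℝ) (p := x))
  have f2 := hdV.comp x (hasFDerivAt_fst (𝕜 := ℝ) (p := x))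
  have f4 := (hasFDerivAt_gauss x.1).comp x (hasFDerivAt_fst (𝕜 := ℝ) (p := x))
  have f3' : HasFDerivAt (fun q : Fin d → ℝ => ∑ j, u.1 j * q j)
      (∑ j, u.1 j • (ContinuousLinearMap.proj j : (Fin d → ℝ) →L[ℝ] ℝ)) x.1 :=
    HasFDerivAt.fun_sum fun i _ =>
      ((ContinuousLinearMap.proj (R := ℝ) (φ := fun _ : Fin d => ℝ) i).hasFDerivAt (x := x.1)).const_mul _
  have f3 := f3'.comp x (hasFDerivAt_fst (𝕜 := ℝ) (p := x))
  have f := (((f1.const_mul (1/2:ℝ)).add f2).add f3).add (f4.const_mul u.2)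
  have hH := f.congr_of_eventuallyEq (f₁ := eucHam V0 u) (Eventually.of_forall fun y => by
    simp only [eucHam, Pi.add_apply, Function.comp]
    ring)
  unfold hamVF eucVF
  rw [hH.fderiv]
  refine Prod.ext ?_ ?_
  · funext i
    simp [sum_apply, Pi.single_apply]
  · funext i
    simp [sum_apply, Pi.single_apply, potA, potB]
    ring

theorem potA_contDiff (V0 : (Fin d → ℝ) → ℝ) (hV0 : ContDiff ℝ (⊤ : ℕ∞) V0) :
    ContDiff ℝ 1 (potA V0) := by
  rw [contDiff_pi]
  intro i
  have h : ContDiff ℝ 1 (fderiv ℝ V0) := 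
    (hV0.fderiv_right (m := ((1 : ℕ∞) : WithTop ℕ∞)) (WithTop.coe_le_coe.2 le_top))
  exact h.clm_apply contDiff_const

theorem potB_contDiff : ContDiff ℝ 1 (potB (d := d)) := by
  rw [contDiff_pi]
  intro i
  unfold potB
  fun_prop

theorem euc_flow (V0 : (Fin d → ℝ) → ℝ) (hV0 : ContDiff ℝ (⊤ : ℕ∞) V0)
    (L : NNReal) (hL : LipschitzWith L (fderiv ℝ V0)) (u : (Fin d → ℝ) × ℝ) :
    ∃ (K : NNReal) (φ : ℝ → Phase d → Phase d), LipschitzWith K (eucVF V0 u) ∧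
      (∀ x, φ 0 x = x) ∧ ∀ x t, HasDerivAt (fun s => φ s x) (eucVF V0 u (φ t x)) t := by
  have hc : ContDiff ℝ 1 (eucVF V0 u) := by
    unfold eucVF
    have h1 := potA_contDiff V0 hV0
    have h2 := potB_contDiff (d := d)
    fun_prop
  have hLip : LipschitzWith (1 + L + ‖u.2‖₊ * (1 + 2 * d)) (eucVF V0 u) := by
    refine LipschitzWith.of_dist_le_mul fun x y => ?_
    rw [dist_eq_norm, dist_eq_norm]
    set z := x - y with hz
    have n1 : ‖x.1 - y.1‖ ≤ ‖z‖ := norm_fst_le z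
    have n2 : ‖x.2 - y.2‖ ≤ ‖z‖ := norm_snd_le z
    have n0 := norm_nonneg z
    have m1 : ‖potA V0 x.1 - potA V0 y.1‖ ≤ L * ‖z‖ := (potA_lip V0 L hL _ _).trans (by gcongr)
    have m2 : ‖potB x.1 - potB y.1‖ ≤ (1 + 2 * d) * ‖z‖ := (potB_lip _ _).trans (by gcongr)
    have m3 : ‖u.2 • (potB x.1 - potB y.1)‖ ≤ ‖u.2‖ * ((1 + 2 * d) * ‖z‖) := by
      rw [norm_smul]; gcongr
    push_cast
    have p1 : 0 ≤ ‖u.2‖ * ((1 + 2 * d) * ‖z‖) := by positivity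
    have p2 : 0 ≤ L * ‖z‖ := by positivity
    refine max_le ?_ ?_
    · change ‖x.2 - y.2‖ ≤ _
      linarith
    · change ‖(-(potA V0 x.1) - u.1 - u.2 • potB x.1) - (-(potA V0 y.1) - u.1 - u.2 • potB y.1)‖ ≤ _
      have e : (-(potA V0 x.1) - u.1 - u.2 • potB x.1) - (-(potA V0 y.1) - u.1 - u.2 • potB y.1) =
        -((potA V0 x.1 - potA V0 y.1) + u.2 • (potB x.1 - potB y.1)) := by
        rw [smul_sub]; abel
      rw [e, norm_neg]
      have := norm_add_le (potA V0 x.1 - potA V0 y.1) (u.2 • (potB x.1 - potB y.1))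
      linarith
  obtain ⟨φ, h0, h1⟩ := aux_global_flow (eucVF V0 u) hc _ hLip
  exact ⟨_, φ, hLip, h0, h1⟩

end grads

section sys
variable {d : ℕ}

/-- A control system together with its flows. -/
structure EucSys (d : ℕ) where
  V0 : (Fin d → ℝ) → ℝ
  L : ℝ
  hL : 0 ≤ L
  lipA : ∀ x y, ‖potA V0 x - potA V0 y‖ ≤ L * ‖x - y‖
  ham : ∀ u, hamVF (eucHam V0 u) = eucVF V0 u
  φ : ((Fin d → ℝ) × ℝ) → ℝ → Phase d → Phase d
  h0 : ∀ u x, φ u 0 x = x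
  h1 : ∀ u x t, HasDerivAt (fun s => φ u s x) (eucVF V0 u (φ u t x)) t
  neg : ∀ u t y, φ u t (φ u (-t) y) = y

theorem eucSys_exists (V0 : (Fin d → ℝ) → ℝ) (hV0 : ContDiff ℝ (⊤ : ℕ∞) V0)
    (hLip : ∃ L : NNReal, LipschitzWith L (fderiv ℝ V0)) : ∃ S : EucSys d, S.V0 = V0 := by
  obtain ⟨L, hL⟩ := hLip
  choose K φ hK h0 h1 using euc_flow V0 hV0 L hL
  exact ⟨⟨V0, L, L.2, potA_lip V0 L hL, hamVF_eucHam V0 hV0, φ, h0, h1,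
    fun u t y => aux_flow_neg _ (K u) (hK u) (φ u) (h0 u) (h1 u) t y⟩, rfl⟩

theorem aux_foldl {α : Type*} (l : List (α → α)) (Φ : α → α) :
    l.foldl (fun g f => f ∘ g) Φ = (l.foldl (fun g f => f ∘ g) id) ∘ Φ := by
  induction l generalizing Φ with
  | nil => rfl
  | cons a l ih =>
    simp only [List.foldl_cons]
    rw [ih, ih (a ∘ id)]
    rfl

theorem Reachable.trans' {U : Type*} {Ham : U → Phase d → ℝ} {τ τ' : ℝ} {Φ Φ' : Phase d → Phase d}
    (h : Reachable Ham τ Φ) (h' : Reachable Ham τ' Φ') : Reachable Ham (τ + τ') (Φ' ∘ Φ) := by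
  obtain ⟨n, dur, u, φ, h1, h2, h3, h4⟩ := h
  obtain ⟨n', dur', u', φ', h1', h2', h3', h4'⟩ := h'
  refine ⟨n + n', Fin.append dur dur', Fin.append u u', Fin.append φ φ', ?_, ?_, ?_, ?_⟩
  · intro i
    refine Fin.addCases (fun j => ?_) (fun j => ?_) i
    · simpa using h1 j
    · simpa using h1' j
  · rw [Fin.sum_univ_add]
    simp [h2, h2']
  · intro i
    refine Fin.addCases (fun j => ?_) (fun j => ?_) i
    · simpa using h3 j
    · simpa using h3' j
  · have : (fun i => Fin.append φ φ' i (Fin.append dur dur' i)) =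
        Fin.append (fun i => φ i (dur i)) (fun i => φ' i (dur' i)) := by
      funext i
      refine Fin.addCases (fun j => ?_) (fun j => ?_) i <;> simp
    rw [this, List.ofFn_fin_append, List.foldl_append, aux_foldl, ← h4, ← h4']

/-- exact ensemble steering in time `τ` -/
def EucSys.Ex (S : EucSys d) {N : ℕ} (τ : ℝ) (x y : Fin N → Phase d) : Prop :=
  0 ≤ τ ∧ ∃ Φ : Phase d → Phase d, Reachable (eucHam S.V0) τ Φ ∧ ∀ i, Φ (x i) = y i

theorem EucSys.Ex.refl (S : EucSys d) {N : ℕ} (x : Fin N → Phase d) : S.Ex 0 x x :=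
  ⟨le_rfl, id, ⟨0, Fin.elim0, Fin.elim0, Fin.elim0, fun i => i.elim0, by simp, fun i => i.elim0,
    by simp⟩, fun _ => rfl⟩

theorem EucSys.Ex.trans {S : EucSys d} {N : ℕ} {τ τ' : ℝ} {x y z : Fin N → Phase d}
    (h : S.Ex τ x y) (h' : S.Ex τ' y z) : S.Ex (τ + τ') x z := by
  obtain ⟨h0, Φ, h1, h2⟩ := h
  obtain ⟨h0', Φ', h1', h2'⟩ := h'
  exact ⟨by positivity, Φ' ∘ Φ, h1.trans' h1', fun i => by rw [Function.comp, h2, h2']⟩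

theorem EucSys.Ex.step (S : EucSys d) {N : ℕ} (u : (Fin d → ℝ) × ℝ) {t : ℝ} (ht : 0 ≤ t)
    (x : Fin N → Phase d) : S.Ex t x (fun i => S.φ u t (x i)) :=
  ⟨ht, S.φ u t, ⟨1, fun _ => t, fun _ => u, fun _ => S.φ u, fun _ => ht, by simp, fun _ => by
    rw [S.ham]; exact ⟨S.h0 u, S.h1 u⟩, by simp⟩, fun _ => rfl⟩

/-- momentum scaling -/
noncomputable def scl (η : ℝ) (x : Phase d) : Phase d := (x.1, η⁻¹ • x.2)

/-- scaled kick -/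
noncomputable def EucSys.kick (S : EucSys d) (u : Fin d → ℝ) (η : ℝ) (e : ℝ × Phase d) : Phase d :=
  ((S.φ ((η ^ 3)⁻¹ • u, (η ^ 3)⁻¹ * e.1) (η ^ 2) (scl η e.2)).1,
    η • (S.φ ((η ^ 3)⁻¹ • u, (η ^ 3)⁻¹ * e.1) (η ^ 2) (scl η e.2)).2)

/-- scaled drift -/
noncomputable def EucSys.drift (S : EucSys d) (η : ℝ) (x : Phase d) : Phase d :=
  ((S.φ 0 η (scl η x)).1, η • (S.φ 0 η (scl η x)).2)

theorem aux_scale (S : EucSys d) (u : (Fin d → ℝ) × ℝ) (c : ℝ) (x : Phase d) (s : ℝ) :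
    HasDerivAt (fun s => S.φ u (c * s) x) (c • eucVF S.V0 u (S.φ u (c * s) x)) s := by
  have h := HasDerivAt.scomp (h := fun s => c * s) (h' := c) s (S.h1 u x (c * s))
    (by simpa using (hasDerivAt_id s).const_mul c)
  exact h

theorem EucSys.kick_usd (S : EucSys d) (u : Fin d → ℝ) (x0 : Phase d) :
    USD (S.kick u) (kickL (potB x0.1)) (0, x0) (x0.1, x0.2 - u) := by
  refine _root_.kick_usd (potA S.V0) potB S.L (1 + 2 * d) 3 S.hL (by positivity) (by norm_num)
    S.lipA potB_bd potB_lip u (S.kick u) ?_ x0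
  intro η hη e
  set w : (Fin d → ℝ) × ℝ := ((η ^ 3)⁻¹ • u, (η ^ 3)⁻¹ * e.1) with hw
  refine ⟨fun s => (S.φ w (η ^ 2 * s) (scl η e.2)).1, fun s => η • (S.φ w (η ^ 2 * s) (scl η e.2)).2,
    ?_, ?_, ?_, ?_, ?_⟩
  · simp [S.h0, scl]
  · simp [S.h0, scl, smul_smul, hη.ne']
  · simp [EucSys.kick, ← hw]
  · intro s
    have h := (hasFDerivAt_fst (𝕜 := ℝ) (E := Fin d → ℝ) (F := Fin d → ℝ)).comp_hasDerivAt s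
      (aux_scale S w (η ^ 2) (scl η e.2) s)
    convert! h using 1
    simp [eucVF, smul_smul, sq]
  · intro s
    have h := ((hasFDerivAt_snd (𝕜 := ℝ) (E := Fin d → ℝ) (F := Fin d → ℝ)).comp_hasDerivAt s
      (aux_scale S w (η ^ 2) (scl η e.2) s)).const_smul η
    convert! h using 1
    ext i
    simp [eucVF, hw]
    field_simp

theorem EucSys.drift_usd (S : EucSys d) (x0 : Phase d) :
    USD S.drift driftL x0 (driftL x0) := by
  refine _root_.drift_usd (potA S.V0) S.L S.hL S.lipA S.drift ?_ x0
  intro η hη x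
  refine ⟨fun s => (S.φ 0 (η * s) (scl η x)).1, fun s => η • (S.φ 0 (η * s) (scl η x)).2,
    ?_, ?_, ?_, ?_, ?_⟩
  · simp [S.h0, scl]
  · simp [S.h0, scl, smul_smul, hη.ne']
  · simp [EucSys.drift]
  · intro s
    have h := (hasFDerivAt_fst (𝕜 := ℝ) (E := Fin d → ℝ) (F := Fin d → ℝ)).comp_hasDerivAt s
      (aux_scale S 0 η (scl η x) s)
    convert! h using 1
  · intro s
    have h := ((hasFDerivAt_snd (𝕜 := ℝ) (E := Fin d → ℝ) (F := Fin d → ℝ)).comp_hasDerivAt s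
      (aux_scale S 0 η (scl η x) s)).const_smul η
    convert! h using 1
    ext i
    simp [eucVF]
    ring

theorem EucSys.scl_kick (S : EucSys d) (u : Fin d → ℝ) {η : ℝ} (hη : 0 < η) (e : ℝ × Phase d) :
    scl η (S.kick u η e) = S.φ ((η ^ 3)⁻¹ • u, (η ^ 3)⁻¹ * e.1) (η ^ 2) (scl η e.2) := by
  rw [scl, EucSys.kick]
  simp [smul_smul, hη.ne']

theorem EucSys.scl_drift (S : EucSys d) {η : ℝ} (hη : 0 < η) (x : Phase d) :
    scl η (S.drift η x) = S.φ 0 η (scl η x) := by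
  rw [scl, EucSys.drift]
  simp [smul_smul, hη.ne']

theorem EucSys.ex_kick (S : EucSys d) {N : ℕ} (u : Fin d → ℝ) (g : ℝ) {η : ℝ} (hη : 0 < η)
    (x : Fin N → Phase d) :
    S.Ex (η ^ 2) (fun i => scl η (x i)) (fun i => scl η (S.kick u η (g, x i))) := by
  simp only [S.scl_kick u hη]
  exact Ex.step S _ (by positivity) _

theorem EucSys.ex_drift (S : EucSys d) {N : ℕ} {η : ℝ} (hη : 0 < η)
    (x : Fin N → Phase d) :
    S.Ex η (fun i => scl η (x i)) (fun i => scl η (S.drift η (x i))) := by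
  simp only [S.scl_drift hη]
  exact Ex.step S _ hη.le _

theorem USD.congr_val {E F : Type*} [NormedAddCommGroup E] [NormedSpace ℝ E]
    [NormedAddCommGroup F] [NormedSpace ℝ F]
    {G : ℝ → E → F} {L : E →L[ℝ] F} {e0 : E} {y0 y1 : F} (h : USD G L e0 y0) (hy : y0 = y1) :
    USD G L e0 y1 := hy ▸ h

/-- composite step -/
noncomputable def EucSys.mstep (S : EucSys d) (v : Fin d → ℝ) (η : ℝ) (e : ℝ × Phase d) :
    Phase d :=
  S.kick (-v) η (0, S.drift η (S.kick (2 • v) η (e.1, S.drift η (S.kick (-v) η (0, e.2)))))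

theorem EucSys.mstep_usd (S : EucSys d) (v q0 : Fin d → ℝ) :
    ∃ L : ℝ × Phase d →L[ℝ] Phase d, USD (S.mstep v) L (0, (q0, 0)) (q0, 0) ∧
      ∀ e, L e = (e.2.1 + (2:ℝ) • e.2.2 - e.1 • potB (q0 + v), e.2.2 - e.1 • potB (q0 + v)) := by
  have fs := USD.clm (ContinuousLinearMap.fst ℝ ℝ (Phase d)) ((0, (q0, 0)) : ℝ × Phase d)
  have g1 := USD.clm ((0 : ℝ × Phase d →L[ℝ] ℝ).prod (ContinuousLinearMap.snd ℝ ℝ (Phase d)))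
    ((0, (q0, 0)) : ℝ × Phase d)
  have g2 := g1.comp (S.kick_usd (-v) (q0, 0))
  have g3 := g2.comp (S.drift_usd _)
  have g4 := (fs.prodMk g3).comp (S.kick_usd (2 • v) _)
  have g5 := g4.comp (S.drift_usd _)
  have z := USD.clm (0 : ℝ × Phase d →L[ℝ] ℝ) ((0, (q0, 0)) : ℝ × Phase d)
  have g6 := (z.prodMk g5).comp (S.kick_usd (-v) _)
  refine ⟨_, g6.congr_val ?_, ?_⟩
  · ext i
    · simp [driftL_apply, two_smul]
    · simp [driftL_apply, two_smul]
  · intro e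
    simp only [driftL_apply, kickL_apply, ContinuousLinearMap.comp_apply,
      ContinuousLinearMap.prod_apply, zero_apply, ContinuousLinearMap.coe_fst',
      ContinuousLinearMap.coe_snd', zero_smul, sub_zero, zero_add, sub_neg_eq_add]
    refine Prod.ext ?_ rfl
    simp only [two_smul]
    abel

end sys

section words
variable {d N : ℕ}

/-- ensemble step -/
noncomputable def EucSys.ens (S : EucSys d) (v : Fin d → ℝ) (η : ℝ) (e : ℝ × (Fin N → Phase d)) :
    Fin N → Phase d := fun i => S.mstep v η (e.1, e.2 i)

theorem EucSys.ens_usd (S : EucSys d) (v : Fin d → ℝ) (qs : Fin N → Fin d → ℝ) :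
    ∃ L : ℝ × (Fin N → Phase d) →L[ℝ] (Fin N → Phase d),
      USD (S.ens v) L (0, fun i => (qs i, 0)) (fun i => (qs i, 0)) ∧
      ∀ e i, L e i = ((e.2 i).1 + (2:ℝ) • (e.2 i).2 - e.1 • potB (qs i + v),
        (e.2 i).2 - e.1 • potB (qs i + v)) := by
  choose L hL hL' using fun i => S.mstep_usd v (qs i)
  have h : ∀ i, USD (fun η (e : ℝ × (Fin N → Phase d)) => S.mstep v η (e.1, e.2 i))
      ((L i).comp ((ContinuousLinearMap.fst ℝ ℝ (Fin N → Phase d)).prod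
        ((ContinuousLinearMap.proj i).comp (ContinuousLinearMap.snd ℝ ℝ (Fin N → Phase d)))))
      (0, fun i => (qs i, 0)) (qs i, 0) := by
    intro i
    have h1 := USD.clm ((ContinuousLinearMap.fst ℝ ℝ (Fin N → Phase d)).prod
        ((ContinuousLinearMap.proj i).comp (ContinuousLinearMap.snd ℝ ℝ (Fin N → Phase d))))
        ((0, fun i => (qs i, 0)) : ℝ × (Fin N → Phase d))
    exact h1.comp (hL i)
  refine ⟨_, USD.pi h, fun e i => ?_⟩
  exact hL' i _

theorem EucSys.ens_ex (S : EucSys d) (v : Fin d → ℝ) {η : ℝ} (hη : 0 < η) (hη1 : η ≤ 1)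
    (e : ℝ × (Fin N → Phase d)) :
    ∃ τ ≤ 5 * η, S.Ex τ (fun i => scl η (e.2 i)) (fun i => scl η (S.ens v η e i)) := by
  have h := ((((S.ex_kick (-v) 0 hη e.2).trans (S.ex_drift hη _)).trans
    (S.ex_kick (2 • v) e.1 hη _)).trans (S.ex_drift hη _)).trans (S.ex_kick (-v) 0 hη _)
  exact ⟨_, by nlinarith, h⟩

/-- existence of a family of controlled steps with linearization data -/
def EucSys.Word (S : EucSys d) (qs : Fin N → Fin d → ℝ)
    (T : (Fin N → Phase d) →ₗ[ℝ] (Fin N → Phase d)) (R : Submodule ℝ (Fin N → Phase d)) : Prop :=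
  ∃ (k : ℕ) (G : ℝ → (Fin k → ℝ) × (Fin N → Phase d) → (Fin N → Phase d))
    (L : (Fin k → ℝ) × (Fin N → Phase d) →L[ℝ] (Fin N → Phase d)) (C : ℝ),
    USD G L (0, fun i => (qs i, 0)) (fun i => (qs i, 0)) ∧ (∀ x, L (0, x) = T x) ∧
    (∀ r ∈ R, ∃ e, L (e, 0) = r) ∧
    ∀ η : ℝ, 0 < η → η ≤ 1 → ∀ e : (Fin k → ℝ) × (Fin N → Phase d),
      ∃ τ ≤ C * η, S.Ex τ (fun i => scl η (e.2 i)) (fun i => scl η (G η e i))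

theorem EucSys.word_nil (S : EucSys d) (qs : Fin N → Fin d → ℝ) :
    S.Word qs LinearMap.id ⊥ := by
  refine ⟨0, fun _ e => e.2, ContinuousLinearMap.snd ℝ _ _, 0,
    USD.clm (ContinuousLinearMap.snd ℝ (Fin 0 → ℝ) (Fin N → Phase d)) _, fun x => rfl, ?_, ?_⟩
  · intro r hr
    exact ⟨0, by simpa using ((Submodule.mem_bot ℝ).1 hr).symm⟩
  · intro η h0 h1 e
    exact ⟨0, by simp, Ex.refl S _⟩

/-- linear part of the ensemble step -/
def stepA : (Fin N → Phase d) →ₗ[ℝ] (Fin N → Phase d) where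
  toFun x i := ((x i).1 + (2:ℝ) • (x i).2, (x i).2)
  map_add' x y := by ext i j <;> simp <;> ring
  map_smul' c x := by ext i j <;> simp <;> ring

/-- control direction of the ensemble step -/
noncomputable def stepB (qs : Fin N → Fin d → ℝ) (v : Fin d → ℝ) : Fin N → Phase d :=
  fun i => (-potB (qs i + v), -potB (qs i + v))

theorem EucSys.word_cons (S : EucSys d) (qs : Fin N → Fin d → ℝ)
    {T : (Fin N → Phase d) →ₗ[ℝ] (Fin N → Phase d)} {R : Submodule ℝ (Fin N → Phase d)}
    (h : S.Word qs T R) (v : Fin d → ℝ) :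
    S.Word qs (T ∘ₗ stepA) (R ⊔ Submodule.span ℝ {T (stepB qs v)}) := by
  obtain ⟨k, G, L, C, hG, hT, hR, hE⟩ := h
  obtain ⟨M, hM, hM'⟩ := S.ens_usd v qs
  have hMe : ∀ e, M e = stepA e.2 + e.1 • stepB qs v := by
    intro e
    funext i
    rw [hM']
    refine Prod.ext ?_ ?_ <;> simp [stepA, stepB, sub_eq_add_neg]
  let tl : (Fin (k+1) → ℝ) →L[ℝ] (Fin k → ℝ) :=
    ContinuousLinearMap.pi fun i => ContinuousLinearMap.proj i.succ
  let hd : (Fin (k+1) → ℝ) →L[ℝ] ℝ := ContinuousLinearMap.proj 0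
  let f1 := ContinuousLinearMap.fst ℝ (Fin (k+1) → ℝ) (Fin N → Phase d)
  let f2 := ContinuousLinearMap.snd ℝ (Fin (k+1) → ℝ) (Fin N → Phase d)
  let z0 : (Fin (k+1) → ℝ) × (Fin N → Phase d) := (0, fun i => (qs i, 0))
  have u1 := (USD.clm ((hd.comp f1).prod f2) z0).comp hM
  have u2 := ((USD.clm (tl.comp f1) z0).prodMk u1).comp hG
  refine ⟨k + 1, _, _, C + 5, u2, ?_, ?_, ?_⟩
  · intro x
    change L (tl 0, M (hd 0, x)) = _
    rw [map_zero, map_zero, hMe]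
    simp [hT]
  · intro r hr
    obtain ⟨r1, hr1, r2, hr2, rfl⟩ := Submodule.mem_sup.1 hr
    obtain ⟨c, rfl⟩ := Submodule.mem_span_singleton.1 hr2
    obtain ⟨e, rfl⟩ := hR r1 hr1
    refine ⟨Fin.cons c e, ?_⟩
    change L (tl (Fin.cons c e), M (hd (Fin.cons c e), 0)) = _
    have e1 : tl (Fin.cons c e) = e := by funext i; simp [tl]
    have e2 : hd (Fin.cons c e) = c := by simp [hd]
    rw [e1, e2, hMe, map_zero, zero_add]
    have : ((e, c • stepB qs v) : (Fin k → ℝ) × (Fin N → Phase d)) =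
      (e, 0) + (0, c • stepB qs v) := by simp
    rw [this, map_add, hT, map_smul]
  · intro η h0 h1 e
    obtain ⟨τ, hτ, hx⟩ := S.ens_ex v h0 h1 (hd e.1, e.2)
    obtain ⟨τ', hτ', hx'⟩ := hE η h0 h1 (tl e.1, S.ens v η (hd e.1, e.2))
    exact ⟨τ + τ', by linarith, hx.trans hx'⟩

theorem stepA_surj : Function.Surjective (stepA (d := d) (N := N)) := by
  intro y
  refine ⟨fun i => ((y i).1 - (2:ℝ) • (y i).2, (y i).2), ?_⟩
  funext i
  simp [stepA]

theorem EucSys.word_top (S : EucSys d) (qs : Fin N → Fin d → ℝ)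
    (hspan : ∀ K : Submodule ℝ (Fin N → Fin d → ℝ),
      (∀ v, (fun i => potB (qs i + v)) ∈ K) → K = ⊤) : ∃ T, S.Word qs T ⊤ := by
  obtain ⟨R, ⟨T, hTs, hTR⟩, hmax⟩ := (wellFounded_gt (α := Submodule ℝ (Fin N → Phase d))).has_min
    {R | ∃ T : (Fin N → Phase d) →ₗ[ℝ] (Fin N → Phase d), Function.Surjective T ∧ S.Word qs T R}
    ⟨⊥, LinearMap.id, fun x => ⟨x, rfl⟩, S.word_nil qs⟩
  have key : ∀ T : (Fin N → Phase d) →ₗ[ℝ] (Fin N → Phase d), Function.Surjective T →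
      S.Word qs T R → ∀ v, T (stepB qs v) ∈ R ∧ S.Word qs (T ∘ₗ stepA) R := by
    intro T hT hW v
    have h1 := S.word_cons qs hW v
    have h2 := hmax _ ⟨T ∘ₗ stepA, hT.comp stepA_surj, h1⟩
    have h3 : R ⊔ Submodule.span ℝ {T (stepB qs v)} = R := by
      by_contra hne
      exact h2 (lt_of_le_of_ne le_sup_left (Ne.symm hne))
    rw [h3] at h1
    refine ⟨?_, h1⟩
    have h4 : Submodule.span ℝ {T (stepB qs v)} ≤ R := by rw [← h3]; exact le_sup_right
    exact h4 (Submodule.mem_span_singleton_self _)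
  have k1 : ∀ v, T (stepB qs v) ∈ R := fun v => (key T hTs hTR v).1
  have k2 : ∀ v, T (stepA (stepB qs v)) ∈ R := fun v =>
    (key (T ∘ₗ stepA) (hTs.comp stepA_surj) (key T hTs hTR v).2 v).1
  let i1 : (Fin N → Fin d → ℝ) →ₗ[ℝ] (Fin N → Phase d) :=
    { toFun := fun w i => (w i, 0)
      map_add' := fun x y => by ext i j <;> simp
      map_smul' := fun c x => by ext i j <;> simp }
  let i2 : (Fin N → Fin d → ℝ) →ₗ[ℝ] (Fin N → Phase d) :=
    { toFun := fun w i => (0, w i)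
      map_add' := fun x y => by ext i j <;> simp
      map_smul' := fun c x => by ext i j <;> simp }
  have m1 : ∀ v, T (i1 fun i => potB (qs i + v)) ∈ R := by
    intro v
    have e : i1 (fun i => potB (qs i + v)) =
        (-(1/2) : ℝ) • (stepA (stepB qs v) - stepB qs v) := by
      ext i j <;> simp [i1, stepA, stepB]
    rw [e, map_smul, map_sub]
    exact R.smul_mem _ (R.sub_mem (k2 v) (k1 v))
  have m2 : ∀ v, T (i2 fun i => potB (qs i + v)) ∈ R := by
    intro v
    have e : i2 (fun i => potB (qs i + v)) =
        -(stepB qs v) - i1 (fun i => potB (qs i + v)) := by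
      ext i j <;> simp [i1, i2, stepB]
    rw [e, map_sub, map_neg]
    exact R.sub_mem (R.neg_mem (k1 v)) (m1 v)
  have t1 := hspan (R.comap (T ∘ₗ i1)) m1
  have t2 := hspan (R.comap (T ∘ₗ i2)) m2
  refine ⟨T, ?_⟩
  have : R = ⊤ := by
    rw [eq_top_iff]
    intro y _
    obtain ⟨x, rfl⟩ := hTs y
    have e : x = i1 (fun i => (x i).1) + i2 (fun i => (x i).2) := by
      ext i j <;> simp [i1, i2]
    rw [e, map_add]
    have a1 : (fun i => (x i).1) ∈ R.comap (T ∘ₗ i1) := by rw [t1]; trivial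
    have a2 : (fun i => (x i).2) ∈ R.comap (T ∘ₗ i2) := by rw [t2]; trivial
    exact R.add_mem a1 a2
  rw [← this]; exact hTR

end words

section interp

theorem aux_se (θ : ℝ) (hθ : 0 < θ) (A B : ℝ) :
    Tendsto (fun s : ℝ => (A - s * B) * Real.exp (-(θ * s))) atTop (𝓝 0) := by
  have h1 : Tendsto (fun s : ℝ => θ * s) atTop atTop := tendsto_id.const_mul_atTop hθ
  have h2 := (Real.tendsto_pow_mul_exp_neg_atTop_nhds_zero 0).comp h1
  have h3 := (Real.tendsto_pow_mul_exp_neg_atTop_nhds_zero 1).comp h1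
  have h := (h2.const_mul A).sub (h3.const_mul (B / θ))
  simp only [mul_zero, sub_zero] at h
  refine h.congr fun s => ?_
  simp only [Function.comp, pow_zero, pow_one]
  field_simp

theorem aux_lim {N : ℕ} (A B θ : Fin N → ℝ) (m : Fin N)
    (h : ∀ s : ℝ, ∑ i, (A i - s * B i) * Real.exp (-(θ i * s)) = 0) (hm : θ m = 0)
    (hi : ∀ i, i ≠ m → (A i = 0 ∧ B i = 0) ∨ 0 < θ i) : A m = 0 := by
  have h1 : Tendsto (fun s : ℝ => ∑ i ∈ Finset.univ.erase m, (A i - s * B i) * Real.exp (-(θ i * s)))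
      atTop (𝓝 0) := by
    rw [← Finset.sum_const_zero (s := Finset.univ.erase m)]
    refine tendsto_finsetSum _ fun i him => ?_
    rcases hi i (Finset.ne_of_mem_erase him) with ⟨hA, hB⟩ | hθ
    · simp [hA, hB]
    · exact aux_se _ hθ _ _
  have h2 : Tendsto (fun s : ℝ => A m - s * B m) atTop (𝓝 0) := by
    have := h1.neg
    rw [neg_zero] at this
    refine this.congr fun s => ?_
    have e := h s
    rw [← Finset.add_sum_erase _ _ (Finset.mem_univ m), hm] at e
    simp only [zero_mul, neg_zero, Real.exp_zero, mul_one] at e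
    linarith
  have h3 := (h2.comp (tendsto_atTop_add_const_right atTop (1:ℝ) tendsto_id)).sub h2
  have hB : -B m = 0 := by
    refine tendsto_nhds_unique (f := fun _ : ℝ => -B m) (l := atTop) tendsto_const_nhds ?_
    rw [sub_zero] at h3
    refine h3.congr fun s => ?_
    simp only [Function.comp, id]
    ring
  rw [neg_eq_zero] at hB
  simp only [hB, mul_zero, sub_zero] at h2
  exact tendsto_nhds_unique tendsto_const_nhds h2

variable {d N : ℕ}

theorem aux_gauss_indep (qs c : Fin N → Fin d → ℝ) (hq : Function.Injective qs)
    (h : ∀ v, ∑ i, potB (qs i + v) ⬝ᵥ c i = 0) : c = 0 := by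
  by_contra hc
  obtain ⟨i0, hi0⟩ := Function.ne_iff.1 hc
  obtain ⟨m, hm, hmax⟩ := Finset.exists_max_image (Finset.univ.filter fun i => c i ≠ 0)
    (fun i => qs i ⬝ᵥ qs i) ⟨i0, by simpa using hi0⟩
  simp only [Finset.mem_filter, Finset.mem_univ, true_and] at hm hmax
  set b : Fin d → ℝ := qs m - c m with hb
  set al : Fin N → ℝ := fun i => Real.exp (-(qs i ⬝ᵥ qs i) / 2 + qs i ⬝ᵥ b) with hal
  have key := aux_lim (fun i => ((qs i - b) ⬝ᵥ c i) * al i) (fun i => (qs m ⬝ᵥ c i) * al i)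
    (fun i => qs m ⬝ᵥ qs m - qs i ⬝ᵥ qs m) m ?_ (sub_self _) ?_
  · have h1 : al m ≠ 0 := (Real.exp_pos _).ne'
    have h2 := (mul_eq_zero.1 key).resolve_right h1
    rw [hb, sub_sub_cancel, dotProduct_self_eq_zero] at h2
    exact hm h2
  · intro s
    have h1 := h (-(b + s • qs m))
    set v := -(b + s • qs m) with hv
    have h2 : ∀ i, potB (qs i + v) ⬝ᵥ c i = -(Real.exp (-(v ⬝ᵥ v) / 2 + (qs m ⬝ᵥ qs m) * s)) *
        (((qs i - b) ⬝ᵥ c i * al i - s * (qs m ⬝ᵥ c i * al i)) *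
          Real.exp (-((qs m ⬝ᵥ qs m - qs i ⬝ᵥ qs m) * s))) := by
      intro i
      have e1 : potB (qs i + v) = (-Real.exp (-((qs i + v) ⬝ᵥ (qs i + v)) / 2)) • (qs i + v) := by
        funext j
        simp only [potB, dotProduct, Pi.smul_apply, smul_eq_mul, sq]
        ring
      have e2 : Real.exp (-((qs i + v) ⬝ᵥ (qs i + v)) / 2) =
          Real.exp (-(v ⬝ᵥ v) / 2 + (qs m ⬝ᵥ qs m) * s) * (al i *
          Real.exp (-((qs m ⬝ᵥ qs m - qs i ⬝ᵥ qs m) * s))) := by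
        rw [hal, ← Real.exp_add, ← Real.exp_add]
        congr 1
        rw [add_dotProduct, dotProduct_add, dotProduct_add, dotProduct_comm v (qs i)]
        have : qs i ⬝ᵥ v = -(qs i ⬝ᵥ b) - s * (qs i ⬝ᵥ qs m) := by
          rw [hv, dotProduct_neg, dotProduct_add, dotProduct_smul, smul_eq_mul]; ring
        rw [this]; ring
      have e3 : (qs i + v) ⬝ᵥ c i = (qs i - b) ⬝ᵥ c i - s * (qs m ⬝ᵥ c i) := by
        rw [hv, add_dotProduct, neg_dotProduct, add_dotProduct, smul_dotProduct,
          sub_dotProduct (qs i) b, smul_eq_mul]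
        ring
      rw [e1, smul_dotProduct, e2, e3, smul_eq_mul]
      ring
    rw [Finset.sum_congr rfl fun i _ => h2 i, ← Finset.mul_sum] at h1
    exact (mul_eq_zero.1 h1).resolve_left (neg_ne_zero.2 (Real.exp_pos _).ne')
  · intro i him
    by_cases hci : c i = 0
    · left; simp [hci]
    · right
      have h1 := hmax i hci
      have h2 : qs i - qs m ≠ 0 := sub_ne_zero.2 (hq.ne him)
      have h3 : 0 ≤ (qs i - qs m) ⬝ᵥ (qs i - qs m) :=
        Finset.sum_nonneg fun j _ => mul_self_nonneg _
      have h4 : (qs i - qs m) ⬝ᵥ (qs i - qs m) ≠ 0 := fun h => h2 (dotProduct_self_eq_zero.1 h)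
      have h5 : (qs i - qs m) ⬝ᵥ (qs i - qs m) = qs i ⬝ᵥ qs i - 2 * (qs i ⬝ᵥ qs m) + qs m ⬝ᵥ qs m := by
        rw [sub_dotProduct, dotProduct_sub, dotProduct_sub, dotProduct_comm (qs m) (qs i)]; ring
      have h6 := lt_of_le_of_ne h3 h4.symm
      linarith

theorem potB_span (qs : Fin N → Fin d → ℝ) (hq : Function.Injective qs)
    (K : Submodule ℝ (Fin N → Fin d → ℝ)) (hK : ∀ v, (fun i => potB (qs i + v)) ∈ K) : K = ⊤ := by
  by_contra hne
  obtain ⟨f, hf, hfK⟩ := Submodule.exists_le_ker_of_lt_top K (lt_top_iff_ne_top.2 hne)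
  have hrep : ∀ w : Fin N → Fin d → ℝ,
      f w = ∑ i, w i ⬝ᵥ (fun j => f (Pi.single i (Pi.single j 1))) := by
    intro w
    have e : w = ∑ i, ∑ j, w i j • (Pi.single i (Pi.single j 1) : Fin N → Fin d → ℝ) := by
      funext i j
      simp [Finset.sum_apply, Pi.single_apply, ite_apply, Finset.sum_ite_eq]
    conv_lhs => rw [e]
    simp [map_sum, dotProduct]
  have := aux_gauss_indep qs (fun i j => f (Pi.single i (Pi.single j 1))) hq (fun v => by
    rw [← hrep fun i => potB (qs i + v)]
    exact hfK (hK v))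
  apply hf
  refine LinearMap.ext fun w => ?_
  rw [hrep, LinearMap.zero_apply]
  refine Finset.sum_eq_zero fun i _ => ?_
  rw [congrFun this i, Pi.zero_apply, dotProduct_zero]

end interp

section final
variable {d N : ℕ}

theorem EucSys.local_ctrl (S : EucSys d) (qs : Fin N → Fin d → ℝ) (hq : Function.Injective qs) :
    ∃ δ > 0, ∀ ε > 0, ∀ x y : Fin N → Phase d, (∀ i, ‖(x i).1 - qs i‖ < δ) →
      (∀ i, ‖(y i).1 - qs i‖ < δ) → ∃ τ ≤ ε, S.Ex τ x y := by
  obtain ⟨T, k, G, L, C, hG, hT, hR, hE⟩ := S.word_top qs (potB_span qs hq)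
  obtain ⟨δ, hδ, hs⟩ := hG.surj (by
    rw [LinearMap.range_eq_top]
    intro y
    obtain ⟨e, he⟩ := hR y trivial
    exact ⟨e, he⟩)
  refine ⟨δ, hδ, fun ε hε x y hx hy => ?_⟩
  have hsm : ∀ c : ℝ, ∀ r : ℝ, 0 < r → ∀ᶠ η in 𝓝[>] (0:ℝ), c * η < r := by
    intro c r hr
    have : Tendsto (fun η : ℝ => c * η) (𝓝 0) (𝓝 (c * 0)) := tendsto_id.const_mul c
    rw [mul_zero] at this
    exact (this.eventually_lt_const hr).filter_mono nhdsWithin_le_nhds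
  have hev : ∀ᶠ η in 𝓝[>] (0:ℝ), 0 < η ∧ 1 * η < δ ∧ 1 * η < 1 ∧ C * η < ε ∧
      (∀ i, ‖(x i).2‖ * η < δ) ∧ (∀ i, ‖(y i).2‖ * η < δ) := by
    refine Eventually.and self_mem_nhdsWithin ((hsm _ _ hδ).and ((hsm _ _ one_pos).and
      ((hsm _ _ hε).and (Eventually.and ?_ ?_))))
    · exact eventually_all.2 fun i => hsm _ _ hδ
    · exact eventually_all.2 fun i => hsm _ _ hδ
  obtain ⟨η, h0, h1, h2, h3, h4, h5⟩ := hev.exists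
  rw [one_mul] at h1 h2
  have hball : ∀ z : Fin N → Phase d, (∀ i, ‖(z i).1 - qs i‖ < δ) → (∀ i, ‖(z i).2‖ * η < δ) →
      (fun i => ((z i).1, η • (z i).2)) ∈ Metric.ball (fun i => ((qs i, 0) : Phase d)) δ := by
    intro z hz1 hz2
    rw [Metric.mem_ball, dist_pi_lt_iff hδ]
    intro i
    rw [Prod.dist_eq]
    refine max_lt ?_ ?_
    · rw [dist_eq_norm]; exact hz1 i
    · rw [dist_zero_right, norm_smul, Real.norm_of_nonneg h0.le, mul_comm]; exact hz2 i
  have hscl : ∀ z : Fin N → Phase d, (fun i => scl η ((z i).1, η • (z i).2)) = z := by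
    intro z
    funext i
    simp [scl, smul_smul, h0.ne']
  obtain ⟨e, he⟩ := hs η h0 h1 _ (hball x hx h4) _ (hball y hy h5)
  obtain ⟨τ, hτ, hX⟩ := hE η h0 h2.le (e, fun i => ((x i).1, η • (x i).2))
  rw [he] at hX
  simp only at hX
  rw [hscl, hscl] at hX
  exact ⟨τ, hτ.trans h3.le, hX⟩

theorem EucSys.pos_ctrl (S : EucSys d) (x y : Fin N → Phase d)
    (hx : Function.Injective fun i => (x i).1) (hy : Function.Injective fun i => (y i).1)
    {ε : ℝ} (hε : 0 < ε) : ∃ τ ≤ ε, S.Ex τ x y := by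
  obtain ⟨δ, hδ, h1⟩ := S.local_ctrl _ hx
  obtain ⟨δ', hδ', h2⟩ := S.local_ctrl _ hy
  set w : Fin N → Phase d := fun i => ((x i).1, (y i).1 - (x i).1) with hw
  have hdr : ∀ i, ∀ᶠ η in 𝓝[>] (0:ℝ), ‖(S.drift η (w i)).1 - (y i).1‖ < δ' := by
    intro i
    have h := (S.drift_usd (w i)).tends
    have h' := ((continuous_fst.tendsto _).comp h)
    have e : (driftL (w i)).1 = (y i).1 := by simp [driftL_apply, hw]
    rw [e] at h'
    have := Metric.tendsto_nhds.1 h' δ' hδ'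
    simpa only [dist_eq_norm, Function.comp] using this
  have hsm : ∀ᶠ η in 𝓝[>] (0:ℝ), η < ε / 3 :=
    (eventually_lt_nhds (by positivity)).filter_mono nhdsWithin_le_nhds
  obtain ⟨η, ha, hb, hc⟩ := ((eventually_all.2 hdr).and (hsm.and self_mem_nhdsWithin)).exists
  have hη : 0 < η := hc
  obtain ⟨τ1, ht1, e1⟩ := h1 (ε / 3) (by positivity) x (fun i => scl η (w i))
    (fun i => by simpa using hδ) (fun i => by simpa [scl, hw] using hδ)
  obtain ⟨τ2, ht2, e2⟩ := h2 (ε / 3) (by positivity) (fun i => scl η (S.drift η (w i))) y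
    (fun i => ha i) (fun i => by simpa using hδ')
  exact ⟨_, by linarith, (e1.trans (S.ex_drift hη w)).trans e2⟩

theorem EucSys.sep (S : EucSys d) {x y : Phase d} (hxy : x ≠ y) :
    ∀ᶠ t in 𝓝[≠] (0:ℝ), (S.φ 0 t x).1 ≠ (S.φ 0 t y).1 := by
  have hd : ∀ z : Phase d, HasDerivAt (fun t => (S.φ 0 t z).1) z.2 0 := by
    intro z
    have h := (hasFDerivAt_fst (𝕜 := ℝ) (E := Fin d → ℝ) (F := Fin d → ℝ)).comp_hasDerivAt 0
      (S.h1 0 z 0)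
    convert! h using 1
    simp [eucVF, S.h0]
  have h := (hd x).fun_sub (hd y)
  by_cases h2 : x.2 - y.2 = 0
  · have h1 : x.1 - y.1 ≠ 0 := fun h1 => hxy (Prod.ext (sub_eq_zero.1 h1) (sub_eq_zero.1 h2))
    have hc := h.continuousAt.eventually_ne (y := 0) (by simpa [S.h0] using h1)
    exact (hc.filter_mono nhdsWithin_le_nhds).mono fun t ht => sub_ne_zero.1 ht
  · exact (h.eventually_ne (c := 0) h2).mono fun t ht => sub_ne_zero.1 ht

theorem EucSys.main (S : EucSys d) (x y : Fin N → Phase d) (hx : Function.Injective x)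
    (hy : Function.Injective y) {ε : ℝ} (hε : 0 < ε) : ∃ τ ≤ ε, S.Ex τ x y := by
  have hsep : ∀ z : Fin N → Phase d, Function.Injective z →
      ∀ᶠ t in 𝓝[≠] (0:ℝ), Function.Injective fun i => (S.φ 0 t (z i)).1 := by
    intro z hz
    have : ∀ᶠ t in 𝓝[≠] (0:ℝ), ∀ i j, i ≠ j → (S.φ 0 t (z i)).1 ≠ (S.φ 0 t (z j)).1 := by
      refine eventually_all.2 fun i => eventually_all.2 fun j => ?_
      by_cases hij : i = j
      · simp [hij]
      · exact (S.sep (hz.ne hij)).mono fun t ht _ => ht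
    refine this.mono fun t ht i j hij => ?_
    by_contra hne
    exact ht i j hne hij
  have hle : 𝓝[>] (0:ℝ) ≤ 𝓝[≠] 0 := nhdsWithin_mono _ fun t ht => (ne_of_gt ht)
  have hneg : Tendsto (fun t : ℝ => -t) (𝓝[>] 0) (𝓝[≠] 0) := by
    refine tendsto_nhdsWithin_iff.2 ⟨?_, ?_⟩
    · have := (continuous_neg (G := ℝ)).tendsto 0
      rw [neg_zero] at this
      exact this.mono_left nhdsWithin_le_nhds
    · filter_upwards [self_mem_nhdsWithin] with t ht
      exact neg_ne_zero.2 (ne_of_gt ht)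
  have hsm : ∀ᶠ η in 𝓝[>] (0:ℝ), η < ε / 3 :=
    (eventually_lt_nhds (by positivity)).filter_mono nhdsWithin_le_nhds
  obtain ⟨t, h1, h2, h3, h4⟩ := (((hsep x hx).filter_mono hle).and
    ((hneg.eventually (hsep y hy)).and (hsm.and self_mem_nhdsWithin))).exists
  have ht : 0 < t := h4
  obtain ⟨τ, hτ, e⟩ := S.pos_ctrl (fun i => S.φ 0 t (x i)) (fun i => S.φ 0 (-t) (y i)) h1 h2
    (ε := ε / 3) (by positivity)
  have e3 := Ex.step S 0 ht.le (fun i => S.φ 0 (-t) (y i))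
  simp only [S.neg] at e3
  exact ⟨_, by linarith, ((Ex.step S 0 ht.le x).trans e).trans e3⟩

end final

end helpers

/-- **Theorem (small-time exact controllability of finite ensembles of points in `T*ℝ^d`).**
For the Euclidean control system `H_u(q,p) = |p|²/2 + V_0(q) + Σ_{j=1}^d u_j q_j +
u_{d+1} e^{−|q|²/2}` with `V_0` smooth with globally Lipschitz gradient: for every `N`,
all pairwise distinct points `γ¹,…,γᴺ ∈ ℝ^d × ℝ^d`, all pairwise distinct points
`γ̄¹,…,γ̄ᴺ ∈ ℝ^d × ℝ^d` and every `ε > 0`, there are `τ ∈ [0,ε]` and a piecewise constant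
control realizing a flow map `Φ^τ_{H_u}` with `Φ^τ_{H_u}(γⁱ) = γ̄ⁱ` for every `i`. -/
theorem euclidean_exact_ensemble_controllability
    (d : ℕ) (V0 : (Fin d → ℝ) → ℝ) (hV0 : ContDiff ℝ (⊤ : ℕ∞) V0)
    (hLip : ∃ L : NNReal, LipschitzWith L (fderiv ℝ V0))
    (N : ℕ) (γ γ' : Fin N → Phase d)
    (hγ : Function.Injective γ) (hγ' : Function.Injective γ')
    (ε : ℝ) (hε : 0 < ε) :
    ∃ τ ∈ Set.Icc (0:ℝ) ε, ∃ Φ : Phase d → Phase d,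
      Reachable (eucHam V0) τ Φ ∧ ∀ i : Fin N, Φ (γ i) = γ' i := by
  obtain ⟨S, rfl⟩ := eucSys_exists V0 hV0 hLip
  obtain ⟨τ, hτ, h0, Φ, h1, h2⟩ := S.main γ γ' hγ hγ' hε
  exact ⟨τ, ⟨h0, hτ⟩, Φ, h1, h2⟩
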